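/- Let n ≥ 3, let l = max(⌊(n-1)/2⌋+5, n+1), and let S be a compact C^l hypersurface in ℝ^n whose Gaussian curvature is bounded away from zero. Then there exist constants c, κ, C > 0 depending only on S such that for all Q ≥ 2 and all δ ∈ (0,1/2): N_S(Q,δ) ≤ C(δ Q^n + E_n(Q)), where E_3(Q) = Q² exp(c√(log Q)) and E_n(Q) = Q^{n-1}(log Q)^κ for n ≥ 4. -/

import Mathlib

open MeasureTheory

/-- Hessian matrix of `f` at `x`. -/
noncomputable def hess {m : ℕ} (f : (Fin m → ℝ) → ℝ) (x : Fin m → ℝ) :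
    Matrix (Fin m) (Fin m) ℝ :=
  Matrix.of fun i j => fderiv ℝ (fun y => fderiv ℝ f y (Pi.single j 1)) x (Pi.single i 1)

/-- Append a last coordinate to a vector in `ℝ^m`, viewed inside `ℝ^n` (`m = n - 1`). -/
noncomputable def appendV (n m : ℕ) (y : Fin m → ℝ) (z : ℝ) : Fin n → ℝ :=
  fun i => if h : (i : ℕ) < m then y ⟨i, h⟩ else z

namespace HypersurfaceCount

/-- The additive character `θ ↦ exp (2 π i k⬝θ)`, written as a product over the coordinates. -/
noncomputable def char {ι : Type*} [Fintype ι] (k : ι → ℤ) (θ : ι → ℝ) : ℂ :=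
  ∏ i, Complex.exp (2 * Real.pi * Complex.I * k i * θ i)

section Bessel

variable {ι : Type*} [Fintype ι]

lemma char_eq (k : ι → ℤ) (θ : ι → ℝ) :
    char k θ = Complex.exp ((2 * Real.pi * ∑ i, (k i : ℝ) * θ i : ℝ) * Complex.I) := by
  rw [char, ← Complex.exp_sum]
  congr 1
  push_cast
  rw [Finset.mul_sum, Finset.sum_mul]
  exact Finset.sum_congr rfl fun i _ => by ring

lemma char_mul_conj (k l : ι → ℤ) (θ : ι → ℝ) :
    char k θ * (starRingEnd ℂ) (char l θ) = char (k - l) θ := by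
  rw [char_eq, char_eq, char_eq, ← Complex.exp_conj, ← Complex.exp_add]
  congr 1
  rw [map_mul, Complex.conj_I, Complex.conj_ofReal]
  simp only [Pi.sub_apply, Int.cast_sub, sub_mul, Finset.sum_sub_distrib]
  push_cast
  ring

lemma continuous_char (k : ι → ℤ) : Continuous (char k) := by
  unfold char; fun_prop

lemma char_add_int (k w : ι → ℤ) (θ : ι → ℝ) :
    char k (fun i => (w i : ℝ) + θ i) = char k θ := by
  unfold char
  refine Finset.prod_congr rfl fun i _ => ?_
  rw [Complex.exp_eq_exp_iff_exists_int]
  exact ⟨k i * w i, by push_cast; ring⟩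

/-- The half-open unit cube. -/
def cube (ι : Type*) : Set (ι → ℝ) := Set.univ.pi fun _ => Set.Ico (0 : ℝ) 1

lemma volume_cube : volume (cube ι) = 1 := by
  rw [cube, volume_pi_pi]; simp

lemma measurableSet_cube : MeasurableSet (cube ι) :=
  MeasurableSet.univ_pi fun _ => measurableSet_Ico

lemma integrableOn_char (k : ι → ℤ) : IntegrableOn (char k) (cube ι) := by
  refine Measure.integrableOn_of_bounded (M := 1) (by simp [volume_cube])
    (continuous_char k).aestronglyMeasurable ?_
  refine Filter.Eventually.of_forall fun θ => ?_
  rw [char_eq, Complex.norm_exp_ofReal_mul_I]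

lemma integral_char (k : ι → ℤ) :
    ∫ θ in cube ι, char k θ = if k = 0 then 1 else 0 := by
  have h1 : ∫ θ in cube ι, char k θ =
      ∏ i, ∫ x in Set.Ico (0 : ℝ) 1, Complex.exp (2 * Real.pi * Complex.I * k i * x) := by
    rw [cube, volume_pi, Measure.restrict_pi_pi]
    exact integral_fintype_prod_eq_prod (𝕜 := ℂ)
      (fun i (x : ℝ) => Complex.exp (2 * Real.pi * Complex.I * k i * x))
  rw [h1]
  split_ifs with h
  · subst h; simp
  · obtain ⟨i, hi⟩ : ∃ i, k i ≠ 0 := by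
      by_contra! hc; exact h (funext hc)
    refine Finset.prod_eq_zero (Finset.mem_univ i) ?_
    rw [integral_Ico_eq_integral_Ioo, ← integral_Ioc_eq_integral_Ioo,
      ← intervalIntegral.integral_of_le zero_le_one]
    have hc : (2 * Real.pi * Complex.I * k i : ℂ) ≠ 0 := by
      simp [Real.pi_ne_zero, hi]
    rw [integral_exp_mul_complex hc]
    have : Complex.exp (2 * Real.pi * Complex.I * k i * (1 : ℝ)) = 1 := by
      rw [Complex.exp_eq_one_iff]; exact ⟨k i, by push_cast; ring⟩
    rw [this]; simp

/-- Parseval's identity for the trigonometric polynomial with frequency set `F`. -/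
lemma lintegral_sum_char (F : Finset (ι → ℤ)) :
    ∫⁻ θ in cube ι, ENNReal.ofReal (‖∑ z ∈ F, char z θ‖ ^ 2) = F.card := by
  have hcont : Continuous fun θ => ∑ z ∈ F, char (ι := ι) z θ :=
    continuous_finsetSum _ fun z _ => continuous_char z
  have key : ∫ θ in cube ι, ((‖∑ z ∈ F, char z θ‖ ^ 2 : ℝ) : ℂ) = F.card := by
    have : ∀ θ, ((‖∑ z ∈ F, char z θ‖ ^ 2 : ℝ) : ℂ) =
        ∑ z ∈ F, ∑ z' ∈ F, char (z - z') θ := by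
      intro θ
      rw [Complex.ofReal_pow, ← Complex.mul_conj', map_sum, Finset.sum_mul_sum]
      simp_rw [char_mul_conj]
    simp_rw [this]
    rw [integral_finsetSum _ fun z _ => integrable_finsetSum _ fun z' _ => integrableOn_char _]
    simp_rw [integral_finsetSum F fun z' _ => integrableOn_char _, integral_char, sub_eq_zero]
    simp
  have hint : IntegrableOn (fun θ => ‖∑ z ∈ F, char (ι := ι) z θ‖ ^ 2) (cube ι) := by
    refine Measure.integrableOn_of_bounded (M := (F.card : ℝ) ^ 2) (by simp [volume_cube])
      ((hcont.norm).pow 2).aestronglyMeasurable (Filter.Eventually.of_forall fun θ => ?_)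
    rw [Real.norm_of_nonneg (by positivity)]
    gcongr
    refine (norm_sum_le _ _).trans ?_
    refine (Finset.sum_le_card_nsmul _ _ 1 fun z _ => ?_).trans (by simp)
    rw [char_eq, Complex.norm_exp_ofReal_mul_I]
  rw [← ofReal_integral_eq_lintegral_ofReal hint
    (Filter.Eventually.of_forall fun θ => by positivity)]
  rw [integral_complex_ofReal] at key
  have : ∫ θ in cube ι, ‖∑ z ∈ F, char z θ‖ ^ 2 = F.card := by exact_mod_cast key
  rw [this]; simp

lemma half_card_le_norm_sum_char (F : Finset (ι → ℤ)) (θ : ι → ℝ)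
    (h : ∀ z ∈ F, |∑ i, (z i : ℝ) * θ i| ≤ 1 / 6) :
    (F.card : ℝ) / 2 ≤ ‖∑ z ∈ F, char z θ‖ := by
  refine le_trans ?_ (Complex.re_le_norm _)
  rw [Complex.re_sum]
  have : ∀ z ∈ F, (1 / 2 : ℝ) ≤ (char z θ).re := by
    intro z hz
    rw [char_eq, Complex.exp_ofReal_mul_I_re, ← Real.cos_pi_div_three, ← Real.cos_abs (2 * _ * _)]
    refine Real.cos_le_cos_of_nonneg_of_le_pi (abs_nonneg _) (by linarith [Real.pi_pos]) ?_
    rw [abs_mul, abs_of_pos (by positivity : 0 < 2 * Real.pi)]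
    nlinarith [h z hz, Real.pi_pos]
  calc (F.card : ℝ) / 2 = ∑ z ∈ F, (1 / 2 : ℝ) := by simp; ring
    _ ≤ _ := Finset.sum_le_sum this

/-- A dual large-sieve inequality: the frequencies in `F` are all almost orthogonal to the set `Ω`,
and `W` contains every integer point of the difference set `Ω - Ω`. -/
lemma card_mul_volume_le (F W : Finset (ι → ℤ)) (Ω : Set (ι → ℝ)) (hΩ : MeasurableSet Ω)
    (hF : ∀ θ ∈ Ω, ∀ z ∈ F, |∑ i, (z i : ℝ) * θ i| ≤ 1 / 6)
    (hW : ∀ w : ι → ℤ, ∀ θ ∈ Ω, ∀ θ' ∈ Ω, (θ - θ' = fun i => (w i : ℝ)) → w ∈ W) :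
    (F.card : ENNReal) * volume Ω ≤ 4 * W.card := by
  classical
  rcases F.eq_empty_or_nonempty with rfl | hne
  · simp
  set g : (ι → ℝ) → ENNReal := fun θ => ENNReal.ofReal (‖∑ z ∈ F, char z θ‖ ^ 2) with hg
  have hgm : Measurable g := by
    have hcont : Continuous fun θ => ∑ z ∈ F, char (ι := ι) z θ :=
      continuous_finsetSum _ fun z _ => continuous_char z
    exact (ENNReal.continuous_ofReal.comp ((hcont.norm).pow 2)).measurable
  have low : (F.card : ENNReal) ^ 2 / 4 * volume Ω ≤ ∫⁻ θ in Ω, g θ := by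
    rw [← setLIntegral_const]
    refine setLIntegral_mono' hΩ fun θ hθ => ?_
    have := half_card_le_norm_sum_char F θ (hF θ hθ)
    have h2 : ((F.card : ℝ) / 2) ^ 2 ≤ ‖∑ z ∈ F, char z θ‖ ^ 2 := by gcongr
    refine le_trans (le_of_eq ?_) (ENNReal.ofReal_le_ofReal h2)
    rw [div_pow, ENNReal.ofReal_div_of_pos (by norm_num), ENNReal.ofReal_pow (by positivity)]
    norm_num
  have up : ∫⁻ θ in Ω, g θ ≤ W.card * F.card := by
    set v : (ι → ℤ) → ι → ℝ := fun w i => (w i : ℝ) with hv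
    set P : (ι → ℤ) → Set (ι → ℝ) := fun w => Ω ∩ (fun θ => -v w + θ) ⁻¹' cube ι with hP
    have hPm : ∀ w, MeasurableSet (P w) := fun w =>
      hΩ.inter (measurableSet_cube.preimage (measurable_const_add _))
    have hcov : Ω ⊆ ⋃ w, P w := by
      intro θ hθ
      refine Set.mem_iUnion.2 ⟨fun i => ⌊θ i⌋, hθ, ?_⟩
      simp only [cube, Set.mem_preimage, Set.mem_pi, Set.mem_univ, forall_true_left, hv,
        Pi.add_apply, Pi.neg_apply, Set.mem_Ico]
      exact fun i => ⟨by linarith [Int.floor_le (θ i)], by linarith [Int.lt_floor_add_one (θ i)]⟩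
    have hpiece : ∀ w, ∫⁻ θ in P w, g θ =
        ∫⁻ θ in cube ι, ((fun θ => v w + θ) ⁻¹' Ω).indicator g θ := by
      intro w
      rw [← lintegral_indicator (hPm w), ← lintegral_indicator measurableSet_cube,
        ← lintegral_add_left_eq_self _ (v w)]
      refine lintegral_congr fun θ => ?_
      have hgp : g (v w + θ) = g θ := by
        simp only [hg, hv]
        congr 4 with z
        exact char_add_int z w θ
      simp only [Set.indicator_apply, hP, Set.mem_inter_iff, Set.mem_preimage, neg_add_cancel_left,
        hgp]
      split_ifs <;> simp_all
    calc ∫⁻ θ in Ω, g θ ≤ ∫⁻ θ in ⋃ w, P w, g θ := lintegral_mono_set hcov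
      _ ≤ ∑' w, ∫⁻ θ in P w, g θ := lintegral_iUnion_le _ _
      _ = ∫⁻ θ in cube ι, ∑' w, ((fun θ => v w + θ) ⁻¹' Ω).indicator g θ := by
        simp_rw [hpiece]
        refine (lintegral_tsum fun w => ?_).symm
        exact (hgm.indicator (hΩ.preimage (measurable_const_add _))).aemeasurable
      _ ≤ ∫⁻ θ in cube ι, W.card * g θ := by
        refine lintegral_mono fun θ => ?_
        by_cases hex : ∃ w₀, v w₀ + θ ∈ Ω
        · obtain ⟨w₀, hw₀⟩ := hex
          have hz : ∀ w ∉ W.image (w₀ + ·), ((fun θ => v w + θ) ⁻¹' Ω).indicator g θ = 0 := by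
            intro w hw
            refine Set.indicator_of_notMem (fun hmem => hw ?_) _
            refine Finset.mem_image.2 ⟨w - w₀, hW _ _ hmem _ hw₀ ?_, by abel⟩
            ext i; simp [hv]
          rw [tsum_eq_sum hz]
          calc _ ≤ ∑ w ∈ W.image (w₀ + ·), g θ :=
                Finset.sum_le_sum fun w _ => Set.indicator_le_self _ _ _
            _ = W.card * g θ := by
              rw [Finset.sum_const, Finset.card_image_of_injective _ (add_right_injective w₀),
                nsmul_eq_mul]
        · push Not at hex
          have : ∀ w, ((fun θ => v w + θ) ⁻¹' Ω).indicator g θ = 0 := fun w =>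
            Set.indicator_of_notMem (s := (fun θ => v w + θ) ⁻¹' Ω) (hex w) _
          simp [this]
      _ = W.card * F.card := by rw [lintegral_const_mul _ hgm, lintegral_sum_char]
  have hc0 : (F.card : ENNReal) ≠ 0 := by simpa using hne.ne_empty
  have h3 := low.trans up
  rw [pow_two, mul_comm (W.card : ENNReal), mul_div_assoc, mul_assoc,
    ENNReal.mul_le_mul_iff_right hc0 (by simp)] at h3
  calc (F.card : ENNReal) * volume Ω = 4 * (F.card / 4 * volume Ω) := by
        rw [← mul_assoc, ENNReal.mul_div_cancel (by norm_num) (by norm_num)]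
    _ ≤ _ := by gcongr

end Bessel

/-- The ambient space `ℝ^(d+2)`, split as denominator, graph variables, and height. -/
abbrev Amb (d : ℕ) := ℝ × (Fin d → ℝ) × ℝ

/-- The Euclidean inner product on `Amb d`. -/
def ip {d : ℕ} (x x' : Amb d) : ℝ := x.1 * x'.1 + x.2.1 ⬝ᵥ x'.2.1 + x.2.2 * x'.2.2

/-- The isometric involution of `Amb d` that exchanges a hypersurface with its dual. -/
def flip (d : ℕ) : Amb d ≃ₗ[ℝ] Amb d where
  toFun x := (x.2.2, -x.2.1, x.1)
  invFun x := (x.2.2, -x.2.1, x.1)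
  map_add' x y := by ext <;> simp [add_comm]
  map_smul' c x := by ext <;> simp
  left_inv x := by simp
  right_inv x := by simp

lemma abs_dotProduct_le {d : ℕ} (x y : Fin d → ℝ) : |x ⬝ᵥ y| ≤ d * (‖x‖ * ‖y‖) := by
  refine (Finset.abs_sum_le_sum_abs _ _).trans ?_
  refine (Finset.sum_le_card_nsmul _ _ (‖x‖ * ‖y‖) fun i _ => ?_).trans (by simp)
  rw [abs_mul]
  exact mul_le_mul (norm_le_pi_norm x i) (norm_le_pi_norm y i) (abs_nonneg _) (norm_nonneg _)

section Lattice

variable {ι : Type*} {d : ℕ}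

/-- The lattice vector with integer coordinates `z`. -/
def lat (V : (ι → ℝ) ≃ₗ[ℝ] Amb d) (z : ι → ℤ) : Amb d := V fun i => (z i : ℝ)

/-- The dual parametrization. -/
def dual (V : (ι → ℝ) ≃ₗ[ℝ] Amb d) : (ι → ℝ) ≃ₗ[ℝ] Amb d := V.trans (flip d)

lemma flip_apply (x : Amb d) : flip d x = (x.2.2, -x.2.1, x.1) := rfl

lemma lat_dual (V : (ι → ℝ) ≃ₗ[ℝ] Amb d) (z : ι → ℤ) :
    lat (dual V) z = ((lat V z).2.2, -(lat V z).2.1, (lat V z).1) := rfl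

lemma dual_dual (V : (ι → ℝ) ≃ₗ[ℝ] Amb d) : dual (dual V) = V := by
  ext x <;> simp [dual, flip_apply]

lemma lat_neg (V : (ι → ℝ) ≃ₗ[ℝ] Amb d) (z : ι → ℤ) : lat V (-z) = -lat V z := by
  rw [lat, lat, ← map_neg]; congr 1; ext i; simp

variable [Fintype ι]

/-- The linear isomorphism `V` carries the standard inner product to `ip`. -/
def Isometric (V : (ι → ℝ) ≃ₗ[ℝ] Amb d) : Prop := ∀ z w, ip (V z) (V w) = z ⬝ᵥ w

lemma Isometric.dual {V : (ι → ℝ) ≃ₗ[ℝ] Amb d} (hV : Isometric V) : Isometric (dual V) := by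
  intro z w
  rw [← hV z w]
  simp only [HypersurfaceCount.dual, LinearEquiv.trans_apply, flip_apply, ip, neg_dotProduct,
    dotProduct_neg, neg_neg]
  ring

/-- Nonzero lattice vectors have length at least one. -/
lemma Isometric.one_le {V : (ι → ℝ) ≃ₗ[ℝ] Amb d} (hV : Isometric V) {z : ι → ℤ} (hz : z ≠ 0) :
    1 ≤ ip (lat V z) (lat V z) := by
  rw [lat, hV]
  obtain ⟨i, hi⟩ : ∃ i, z i ≠ 0 := by by_contra! hc; exact hz (funext hc)
  have h1 : (1 : ℝ) ≤ (z i : ℝ) * (z i : ℝ) := by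
    have : 1 ≤ z i * z i := by
      have := Int.one_le_abs hi
      nlinarith [abs_mul_abs_self (z i)]
    exact_mod_cast this
  refine h1.trans ?_
  exact Finset.single_le_sum (f := fun i => (z i : ℝ) * (z i : ℝ))
    (fun j _ => mul_self_nonneg _) (Finset.mem_univ i)

lemma finite_lat_of_bounded (V : (ι → ℝ) ≃ₗ[ℝ] Amb d) (R : ℝ) :
    {z : ι → ℤ | ‖lat V z‖ ≤ R}.Finite := by
  obtain ⟨C, hC⟩ : ∃ C : ℝ, ∀ x, ‖V.symm x‖ ≤ C * ‖x‖ :=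
    ⟨_, (LinearMap.toContinuousLinearMap (V.symm : Amb d →ₗ[ℝ] (ι → ℝ))).le_opNorm⟩
  classical
  refine (Set.finite_Icc (fun _ : ι => -⌈|C| * R⌉) (fun _ => ⌈|C| * R⌉)).subset fun z hz => ?_
  have h1 : ∀ i, |(z i : ℝ)| ≤ |C| * R := fun i => by
    have h2 := hC (lat V z)
    rw [lat, LinearEquiv.symm_apply_apply] at h2
    have h3 := norm_le_pi_norm (fun i => (z i : ℝ)) i
    rw [Real.norm_eq_abs] at h3
    refine h3.trans (h2.trans ?_)
    exact mul_le_mul (le_abs_self C) hz (norm_nonneg _) (abs_nonneg _)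
  constructor <;> intro i <;> have := h1 i <;> rw [abs_le] at this
  · have h4 : -(⌈|C| * R⌉ : ℝ) ≤ z i := by linarith [Int.le_ceil (|C| * R)]
    exact_mod_cast h4
  · have h4 : (z i : ℝ) ≤ ⌈|C| * R⌉ := by linarith [Int.le_ceil (|C| * R)]
    exact_mod_cast h4

lemma exists_volume_preimage (V : (ι → ℝ) ≃ₗ[ℝ] Amb d) :
    ∃ κ > (0 : ℝ), ∀ B : Set (Amb d), MeasurableSet B →
      volume (V ⁻¹' B) = ENNReal.ofReal κ * volume B := by
  let Vc := V.toContinuousLinearEquiv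
  have hμ : (Measure.map Vc volume).IsAddHaarMeasure := Vc.isAddHaarMeasure_map volume
  have h1 : (volume : Measure ((Fin d → ℝ) × ℝ)).IsAddHaarMeasure :=
    Measure.prod.instIsAddHaarMeasure volume volume
  have h0 : (volume : Measure (Amb d)).IsAddHaarMeasure :=
    Measure.prod.instIsAddHaarMeasure volume volume
  have hc := Measure.isAddLeftInvariant_eq_smul (Measure.map Vc volume) (volume : Measure (Amb d))
  have hpos := Measure.addHaarScalarFactor_pos_of_isAddHaarMeasure (Measure.map Vc volume)
    (volume : Measure (Amb d))
  refine ⟨_, NNReal.coe_pos.2 hpos, fun B hB => ?_⟩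
  rw [ENNReal.ofReal_coe_nnreal]
  have h2 := congrArg (fun m => m B) hc
  simp only [Measure.smul_apply, ENNReal.smul_def, smul_eq_mul] at h2
  rw [← h2, Measure.map_apply Vc.continuous.measurable hB]
  rfl

/-- A parallelepiped adapted to the contact element `(y, p, u)`. -/
def body (y p : Fin d → ℝ) (u t₀ t₁ t₂ : ℝ) : Set (Amb d) :=
  {x | |x.2.2| ≤ t₂ ∧ ‖x.2.1 + x.2.2 • p‖ ≤ t₁ ∧ |x.1 + x.2.1 ⬝ᵥ y + x.2.2 * u| ≤ t₀}

lemma measurableSet_body (y p : Fin d → ℝ) (u t₀ t₁ t₂ : ℝ) :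
    MeasurableSet (body y p u t₀ t₁ t₂) := by
  have : IsClosed (body y p u t₀ t₁ t₂) := by
    refine IsClosed.inter (s₁ := {x : Amb d | |x.2.2| ≤ t₂})
      (s₂ := {x : Amb d | ‖x.2.1 + x.2.2 • p‖ ≤ t₁ ∧ |x.1 + x.2.1 ⬝ᵥ y + x.2.2 * u| ≤ t₀})
      (isClosed_le (by fun_prop) continuous_const)
      (IsClosed.inter (s₁ := {x : Amb d | ‖x.2.1 + x.2.2 • p‖ ≤ t₁})
        (s₂ := {x : Amb d | |x.1 + x.2.1 ⬝ᵥ y + x.2.2 * u| ≤ t₀})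
        (isClosed_le (by fun_prop) continuous_const) (isClosed_le ?_ continuous_const))
    simp only [dotProduct]
    fun_prop
  exact this.measurableSet

lemma volume_body (y p : Fin d → ℝ) {u t₀ t₁ t₂ : ℝ} (h₀ : 0 < t₀) (h₁ : 0 < t₁) :
    volume (body y p u t₀ t₁ t₂) = ENNReal.ofReal (2 * t₀ * ((2 * t₁) ^ d * (2 * t₂))) := by
  have hm := measurableSet_body y p u t₀ t₁ t₂
  let B' : Set ((Fin d → ℝ) × ℝ) := {x | |x.2| ≤ t₂ ∧ ‖x.1 + x.2 • p‖ ≤ t₁}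
  have hB' : MeasurableSet B' := by
    have : IsClosed B' := IsClosed.inter (s₁ := {x : (Fin d → ℝ) × ℝ | |x.2| ≤ t₂})
      (s₂ := {x : (Fin d → ℝ) × ℝ | ‖x.1 + x.2 • p‖ ≤ t₁})
      (isClosed_le (by fun_prop) continuous_const)
      (isClosed_le (by fun_prop) continuous_const)
    exact this.measurableSet
  rw [Measure.volume_eq_prod, Measure.prod_apply_symm hm]
  have h3 : ∀ x : (Fin d → ℝ) × ℝ, volume ((fun q => (q, x)) ⁻¹' body y p u t₀ t₁ t₂) =
      B'.indicator (fun _ => ENNReal.ofReal (2 * t₀)) x := by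
    intro x
    by_cases hx : x ∈ B'
    · rw [Set.indicator_of_mem hx]
      have : (fun q => (q, x)) ⁻¹' body y p u t₀ t₁ t₂ =
          Metric.closedBall (-(x.1 ⬝ᵥ y + x.2 * u)) t₀ := by
        ext q
        simp only [body, Set.mem_preimage, Set.mem_ofPred_eq, Metric.mem_closedBall, Real.dist_eq,
          sub_neg_eq_add, ← add_assoc]
        exact ⟨fun h => h.2.2, fun h => ⟨hx.1, hx.2, h⟩⟩
      rw [this, Real.volume_closedBall]
    · rw [Set.indicator_of_notMem hx]
      have : (fun q => (q, x)) ⁻¹' body y p u t₀ t₁ t₂ = ∅ := by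
        ext q
        simp only [body, Set.mem_preimage, Set.mem_ofPred_eq, Set.mem_empty_iff_false, iff_false]
        exact fun h => hx ⟨h.1, h.2.1⟩
      rw [this, measure_empty]
  simp_rw [h3]
  rw [lintegral_indicator_const hB', Measure.volume_eq_prod, Measure.prod_apply_symm hB']
  have h4 : ∀ b : ℝ, volume ((fun a => (a, b)) ⁻¹' B') =
      (Metric.closedBall (0 : ℝ) t₂).indicator (fun _ => ENNReal.ofReal ((2 * t₁) ^ d)) b := by
    intro b
    by_cases hb : b ∈ Metric.closedBall (0 : ℝ) t₂
    · rw [Set.indicator_of_mem hb]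
      have : (fun a => (a, b)) ⁻¹' B' = Metric.closedBall (-(b • p)) t₁ := by
        ext a
        simp only [B', Set.mem_preimage, Set.mem_ofPred_eq, Metric.mem_closedBall, dist_eq_norm,
          sub_neg_eq_add]
        rw [Metric.mem_closedBall, Real.dist_eq, sub_zero] at hb
        exact ⟨fun h => h.2, fun h => ⟨hb, h⟩⟩
      rw [this, Real.volume_pi_closedBall _ h₁.le, Fintype.card_fin]
    · rw [Set.indicator_of_notMem hb]
      have : (fun a => (a, b)) ⁻¹' B' = ∅ := by
        ext a
        simp only [B', Set.mem_preimage, Set.mem_ofPred_eq, Set.mem_empty_iff_false, iff_false]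
        rw [Metric.mem_closedBall, Real.dist_eq, sub_zero] at hb
        exact fun h => hb h.1
      rw [this, measure_empty]
  simp_rw [h4]
  rw [lintegral_indicator_const Metric.isClosed_closedBall.measurableSet, Real.volume_closedBall,
    ← ENNReal.ofReal_mul (by positivity), ← ENNReal.ofReal_mul (by positivity)]

/-- Lattice points close to a contact element are controlled by dual lattice points close to the
dual contact element. -/
lemma exists_dual_finset (V : (ι → ℝ) ≃ₗ[ℝ] Amb d) (hV : Isometric V) :
    ∃ K > (0 : ℝ), ∀ (y p : Fin d → ℝ) (u X₀ X₁ X₂ t₀ t₁ t₂ : ℝ) (F : Finset (ι → ℤ)),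
      0 < t₀ → 0 < t₁ → 0 < t₂ → t₀ * X₀ + d * (t₁ * X₁) + t₂ * X₂ ≤ 1 / 6 →
      (∀ z ∈ F, |(lat V z).1| ≤ X₀ ∧ ‖(lat V z).2.1 - (lat V z).1 • y‖ ≤ X₁ ∧
        |(lat V z).2.2 - (lat V z).1 * u - ((lat V z).2.1 - (lat V z).1 • y) ⬝ᵥ p| ≤ X₂) →
      ∃ W : Finset (ι → ℤ), (∀ w ∈ W, |(lat (dual V) w).1| ≤ 2 * t₂ ∧
        ‖(lat (dual V) w).2.1 - (lat (dual V) w).1 • p‖ ≤ 2 * t₁ ∧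
        |(lat (dual V) w).2.2 - (lat (dual V) w).2.1 ⬝ᵥ y + (lat (dual V) w).1 * u| ≤ 2 * t₀) ∧
        (F.card : ℝ) * (t₀ * t₁ ^ d * t₂) ≤ K * W.card := by
  obtain ⟨κ, hκ, hvol⟩ := exists_volume_preimage V
  refine ⟨4 / κ, by positivity, fun y p u X₀ X₁ X₂ t₀ t₁ t₂ F h₀ h₁ h₂ ht hF => ?_⟩
  have hfin : {w : ι → ℤ | |(lat (dual V) w).1| ≤ 2 * t₂ ∧
        ‖(lat (dual V) w).2.1 - (lat (dual V) w).1 • p‖ ≤ 2 * t₁ ∧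
        |(lat (dual V) w).2.2 - (lat (dual V) w).2.1 ⬝ᵥ y + (lat (dual V) w).1 * u|
          ≤ 2 * t₀}.Finite := by
    set A : ℝ := 2 * t₁ + 2 * t₂ * ‖p‖ with hA
    refine (finite_lat_of_bounded (dual V)
      (max (2 * t₂) (max A (2 * t₀ + d * (A * ‖y‖) + 2 * t₂ * |u|)))).subset ?_
    rintro w ⟨hw₁, hw₂, hw₃⟩
    have h5 : ‖(lat (dual V) w).2.1‖ ≤ A := by
      have := norm_add_le ((lat (dual V) w).2.1 - (lat (dual V) w).1 • p) ((lat (dual V) w).1 • p)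
      rw [sub_add_cancel, norm_smul, Real.norm_eq_abs] at this
      have h6 : |(lat (dual V) w).1| * ‖p‖ ≤ 2 * t₂ * ‖p‖ := by gcongr
      linarith
    refine max_le_max hw₁ (max_le_max h5 ?_)
    have h7 := abs_dotProduct_le (lat (dual V) w).2.1 y
    have h8 : (d : ℝ) * (‖(lat (dual V) w).2.1‖ * ‖y‖) ≤ d * (A * ‖y‖) := by gcongr
    have h9 : |(lat (dual V) w).1 * u| ≤ 2 * t₂ * |u| := by rw [abs_mul]; gcongr
    rw [Real.norm_eq_abs]
    rw [abs_le] at *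
    constructor <;> linarith [hw₃.1, hw₃.2, h7.1, h7.2, h9.1, h9.2]
  refine ⟨hfin.toFinset, fun w hw => hfin.mem_toFinset.1 hw, ?_⟩
  have hmain := card_mul_volume_le F hfin.toFinset (V ⁻¹' body y p u t₀ t₁ t₂)
    ((measurableSet_body y p u t₀ t₁ t₂).preimage
      V.toContinuousLinearEquiv.continuous.measurable) ?_ ?_
  · rw [hvol _ (measurableSet_body y p u t₀ t₁ t₂), volume_body y p h₀ h₁,
      ← ENNReal.ofReal_mul hκ.le] at hmain
    have h10 := ENNReal.toReal_mono (by finiteness) hmain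
    rw [ENNReal.toReal_mul, ENNReal.toReal_mul, ENNReal.toReal_ofReal (by positivity)] at h10
    simp only [ENNReal.toReal_natCast, ENNReal.toReal_ofNat] at h10
    rw [div_mul_eq_mul_div, le_div_iff₀ hκ]
    refine le_trans ?_ h10
    have : (1 : ℝ) ≤ 2 ^ d := one_le_pow₀ (by norm_num)
    rw [mul_pow]
    have h11 : 0 ≤ (F.card : ℝ) * κ * (t₀ * t₁ ^ d * t₂) := by positivity
    nlinarith
  · intro θ hθ z hz
    obtain ⟨k₁, k₂, k₃⟩ := hF z hz
    obtain ⟨l₁, l₂, l₃⟩ := hθ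
    have e : ∑ i, (z i : ℝ) * θ i = ip (lat V z) (V θ) := (hV _ _).symm
    rw [e]
    generalize lat V z = x at *
    generalize V θ = ξ at *
    have e2 : ip x ξ = x.1 * (ξ.1 + ξ.2.1 ⬝ᵥ y + ξ.2.2 * u) +
        (x.2.1 - x.1 • y) ⬝ᵥ (ξ.2.1 + ξ.2.2 • p) +
        ξ.2.2 * (x.2.2 - x.1 * u - (x.2.1 - x.1 • y) ⬝ᵥ p) := by
      simp only [ip, sub_dotProduct, dotProduct_add, smul_dotProduct, dotProduct_smul, smul_eq_mul]
      rw [dotProduct_comm y ξ.2.1]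
      ring
    rw [e2]
    have m₁ : |x.1 * (ξ.1 + ξ.2.1 ⬝ᵥ y + ξ.2.2 * u)| ≤ t₀ * X₀ := by
      rw [abs_mul, mul_comm]; gcongr
    have m₂ : |(x.2.1 - x.1 • y) ⬝ᵥ (ξ.2.1 + ξ.2.2 • p)| ≤ d * (t₁ * X₁) := by
      refine (abs_dotProduct_le _ _).trans ?_
      rw [mul_comm t₁]; gcongr
      exact (norm_nonneg _).trans k₂
    have m₃ : |ξ.2.2 * (x.2.2 - x.1 * u - (x.2.1 - x.1 • y) ⬝ᵥ p)| ≤ t₂ * X₂ := by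
      rw [abs_mul]; gcongr
    exact (abs_add_three _ _ _).trans (by linarith)
  · intro w θ hθ θ' hθ' hw
    obtain ⟨l₁, l₂, l₃⟩ := hθ
    obtain ⟨k₁, k₂, k₃⟩ := hθ'
    have e : lat V w = V θ - V θ' := by rw [← map_sub, hw]; rfl
    refine hfin.mem_toFinset.2 ?_
    rw [Set.mem_ofPred_eq, lat_dual, e]
    generalize V θ = ξ at *
    generalize V θ' = ξ' at *
    simp only [Prod.fst_sub, Prod.snd_sub]
    refine ⟨?_, ?_, ?_⟩
    · exact (abs_sub _ _).trans (by linarith)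
    · have : -(ξ.2.1 - ξ'.2.1) - (ξ.2.2 - ξ'.2.2) • p =
          (ξ'.2.1 + ξ'.2.2 • p) - (ξ.2.1 + ξ.2.2 • p) := by module
      rw [this]
      exact (norm_sub_le _ _).trans (by linarith)
    · have : ξ.1 - ξ'.1 - -(ξ.2.1 - ξ'.2.1) ⬝ᵥ y + (ξ.2.2 - ξ'.2.2) * u =
          (ξ.1 + ξ.2.1 ⬝ᵥ y + ξ.2.2 * u) - (ξ'.1 + ξ'.2.1 ⬝ᵥ y + ξ'.2.2 * u) := by
        rw [neg_dotProduct, sub_dotProduct]; ring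
      rw [this]
      exact (abs_sub _ _).trans (by linarith)

end Lattice

/-- A family of contact elements of a hypersurface `b = u` over the variables `y`, with slope `p`
and Legendre transform `v`. The axioms are invariant under exchanging `(y, u)` with `(p, v)`. -/
structure Contact (d : ℕ) (M : Type*) where
  y : M → Fin d → ℝ
  p : M → Fin d → ℝ
  u : M → ℝ
  v : M → ℝ
  rad : M → ℝ
  L : ℝ
  R : ℝ
  ε : ℝ
  B : ℝ
  one_le_L : 1 ≤ L
  ε_pos : 0 < ε
  one_le_B : 1 ≤ B
  add_eq : ∀ m, u m + v m = y m ⬝ᵥ p m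
  norm_p_sub_le : ∀ m m', ‖p m' - p m‖ ≤ L * ‖y m' - y m‖
  norm_y_sub_le : ∀ m m', ‖y m' - y m‖ ≤ L * ‖p m' - p m‖
  taylor_u : ∀ m m', |u m' - u m - p m ⬝ᵥ (y m' - y m)| ≤ L * ‖y m' - y m‖ ^ 2
  taylor_v : ∀ m m', |v m' - v m - y m ⬝ᵥ (p m' - p m)| ≤ L * ‖p m' - p m‖ ^ 2
  rad_le_y : ∀ m m', rad m' ≤ rad m + L * ‖y m' - y m‖
  rad_le_p : ∀ m m', rad m' ≤ rad m + L * ‖p m' - p m‖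
  surj_y : ∀ m, rad m ≤ R → ∀ q, ‖q - y m‖ ≤ ε → ∃ m', y m' = q
  surj_p : ∀ m, rad m ≤ R → ∀ q, ‖q - p m‖ ≤ ε → ∃ m', p m' = q
  norm_y_le : ∀ m, ‖y m‖ ≤ B
  norm_p_le : ∀ m, ‖p m‖ ≤ B
  abs_u_le : ∀ m, |u m| ≤ B
  abs_v_le : ∀ m, |v m| ≤ B

/-- The Legendre dual family. -/
def Contact.swap {d : ℕ} {M : Type*} (c : Contact d M) : Contact d M where
  y := c.p
  p := c.y
  u := c.v
  v := c.u
  rad := c.rad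
  L := c.L
  R := c.R
  ε := c.ε
  B := c.B
  one_le_L := c.one_le_L
  ε_pos := c.ε_pos
  one_le_B := c.one_le_B
  add_eq m := by rw [add_comm, c.add_eq, dotProduct_comm]
  norm_p_sub_le := c.norm_y_sub_le
  norm_y_sub_le := c.norm_p_sub_le
  taylor_u := c.taylor_v
  taylor_v := c.taylor_u
  rad_le_y := c.rad_le_p
  rad_le_p := c.rad_le_y
  surj_y := c.surj_p
  surj_p := c.surj_y
  norm_y_le := c.norm_p_le
  norm_p_le := c.norm_y_le
  abs_u_le := c.abs_v_le
  abs_v_le := c.abs_u_le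

lemma card_Icc_ceil_floor_le (x N : ℝ) (hN : 0 ≤ N) :
    ((Finset.Icc ⌈x - N⌉ ⌊x + N⌋).card : ℝ) ≤ 2 * N + 1 := by
  rw [Int.card_Icc]
  rcases le_or_gt 0 (⌊x + N⌋ + 1 - ⌈x - N⌉) with h | h
  · have : (((⌊x + N⌋ + 1 - ⌈x - N⌉).toNat : ℤ) : ℝ) = ⌊x + N⌋ + 1 - ⌈x - N⌉ := by
      rw [Int.toNat_of_nonneg h]; push_cast; ring
    rw [Int.cast_natCast] at this
    rw [this]
    linarith [Int.floor_le (x + N), Int.le_ceil (x - N)]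
  · rw [Int.toNat_of_nonpos h.le]; push_cast; linarith

lemma mem_Icc_ceil_floor {x N : ℝ} {k : ℤ} (h : |(k : ℝ) - x| ≤ N) :
    k ∈ Finset.Icc ⌈x - N⌉ ⌊x + N⌋ := by
  rw [abs_le] at h
  rw [Finset.mem_Icc, Int.ceil_le, Int.le_floor]
  constructor <;> linarith

lemma card_le_of_box {ι : Type*} [Fintype ι] [DecidableEq ι] (T : Finset (ι → ℤ)) (x N : ι → ℝ)
    (hN : ∀ j, 0 ≤ N j) (hT : ∀ k ∈ T, ∀ j, |(k j : ℝ) - x j| ≤ N j) :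
    (T.card : ℝ) ≤ ∏ j, (2 * N j + 1) := by
  have : T ⊆ Fintype.piFinset fun j => Finset.Icc ⌈x j - N j⌉ ⌊x j + N j⌋ := fun k hk =>
    Fintype.mem_piFinset.2 fun j => mem_Icc_ceil_floor (hT k hk j)
  calc (T.card : ℝ) ≤ ((Fintype.piFinset fun j => Finset.Icc ⌈x j - N j⌉ ⌊x j + N j⌋).card : ℝ) := by
        exact_mod_cast Finset.card_le_card this
    _ = ∏ j, ((Finset.Icc ⌈x j - N j⌉ ⌊x j + N j⌋).card : ℝ) := by
        rw [Fintype.card_piFinset]; push_cast; rfl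
    _ ≤ _ := Finset.prod_le_prod (fun _ _ => by positivity)
        fun j _ => card_Icc_ceil_floor_le _ _ (hN j)

section Slab

variable {d : ℕ} {M : Type*}

/-- Two points in the same slab, one of whose slopes deviates by more than `ρ s³` from the slab's
in the direction `i`, are close if they agree up to `ρ` in all directions but `i`. -/
lemma slab_line_bound (c : Contact d M) {ρ s : ℝ} (hρ : 0 < ρ) (hs : 1 ≤ s) {p' : Fin d → ℝ}
    {m m' : M} {k k' : Fin d → ℤ} {i : Fin d}
    (hk : ∀ j, ρ * k j ≤ c.y m j ∧ c.y m j ≤ ρ * (k j + 1))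
    (hk' : ∀ j, ρ * k' j ≤ c.y m' j ∧ c.y m' j ≤ ρ * (k' j + 1))
    (hΓ : ‖c.p m - p'‖ ≤ ρ * s ^ 4)
    (hψ : |c.u m' - c.u m - p' ⬝ᵥ (c.y m' - c.y m)| ≤ 2 * (ρ ^ 2 * s ^ 4))
    (hi : ρ * s ^ 3 < |c.p m i - p' i|) (hj : ∀ j, j ≠ i → k' j = k j)
    (ht : |(k' i : ℝ) - k i| < s ^ 3 / (4 * c.L)) :
    |(k' i : ℝ) - k i| ≤ 2 * (4 + d) * s := by
  have hL := c.one_le_L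
  have hs0 : 0 < s := by linarith
  set t : ℝ := |(k' i : ℝ) - k i| with ht_def
  rcases eq_or_ne (k' i) (k i) with he | hne
  · rw [ht_def, he, sub_self, abs_zero]; positivity
  have ht1 : 1 ≤ t := by
    have : 1 ≤ |k' i - k i| := Int.one_le_abs (sub_ne_zero.2 hne)
    rw [ht_def]; exact_mod_cast this
  set Δ := c.y m' - c.y m with hΔ
  have hΔj : ∀ j, j ≠ i → |Δ j| ≤ ρ := by
    intro j hji
    have h1 := hk j; have h2 := hk' j
    rw [hj j hji] at h2
    rw [hΔ, Pi.sub_apply, abs_le]; constructor <;> linarith [h1.1, h1.2, h2.1, h2.2]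
  have hΔi : |Δ i - ρ * (k' i - k i)| ≤ ρ := by
    have h1 := hk i; have h2 := hk' i
    rw [hΔ, Pi.sub_apply, abs_le]; constructor <;> linarith [h1.1, h1.2, h2.1, h2.2]
  have hΔi' : |ρ * ((k' i : ℝ) - k i)| = ρ * t := by rw [abs_mul, abs_of_pos hρ]
  have hup : |Δ i| ≤ ρ * (t + 1) := by
    have := abs_add_le (Δ i - ρ * (k' i - k i)) (ρ * (k' i - k i))
    rw [sub_add_cancel, hΔi'] at this; linarith
  have hlow : ρ * (t - 1) ≤ |Δ i| := by
    have := abs_sub_abs_le_abs_sub (ρ * ((k' i : ℝ) - k i)) (Δ i)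
    rw [hΔi', abs_sub_comm] at this; linarith
  have hΔn : ‖Δ‖ ≤ ρ * (t + 1) := by
    rw [pi_norm_le_iff_of_nonneg (by positivity)]
    intro j
    rw [Real.norm_eq_abs]
    rcases eq_or_ne j i with rfl | hji
    · exact hup
    · exact (hΔj j hji).trans (by nlinarith)
  have hdot : |(c.p m - p') ⬝ᵥ Δ| ≤ 2 * (ρ ^ 2 * s ^ 4) + c.L * (ρ * (t + 1)) ^ 2 := by
    have h1 := c.taylor_u m m'
    have h2 : c.L * ‖Δ‖ ^ 2 ≤ c.L * (ρ * (t + 1)) ^ 2 := by gcongr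
    have : (c.p m - p') ⬝ᵥ Δ = (c.u m' - c.u m - p' ⬝ᵥ Δ) - (c.u m' - c.u m - c.p m ⬝ᵥ Δ) := by
      rw [sub_dotProduct]; ring
    rw [this]
    exact (abs_sub _ _).trans (by linarith)
  have hsum : |(c.p m i - p' i) * Δ i| ≤
      |(c.p m - p') ⬝ᵥ Δ| + d * (ρ * s ^ 4 * ρ) := by
    have h1 : (c.p m - p') ⬝ᵥ Δ = (c.p m i - p' i) * Δ i +
        ∑ j ∈ Finset.univ.erase i, (c.p m j - p' j) * Δ j := by
      rw [dotProduct, ← Finset.add_sum_erase _ _ (Finset.mem_univ i)]; rfl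
    have h2 : |∑ j ∈ Finset.univ.erase i, (c.p m j - p' j) * Δ j| ≤ d * (ρ * s ^ 4 * ρ) := by
      refine (Finset.abs_sum_le_sum_abs _ _).trans ?_
      refine (Finset.sum_le_card_nsmul _ _ (ρ * s ^ 4 * ρ) fun j hj => ?_).trans ?_
      · rw [abs_mul]
        have := (norm_le_pi_norm (c.p m - p') j).trans hΓ
        have h3 := hΔj j (Finset.ne_of_mem_erase hj)
        rw [Real.norm_eq_abs] at this
        exact mul_le_mul this h3 (abs_nonneg _) (by positivity)
      · rw [nsmul_eq_mul]
        gcongr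
        exact (Finset.card_le_card (Finset.erase_subset _ _)).trans (by simp)
    have h3 := abs_sub ((c.p m - p') ⬝ᵥ Δ) (∑ j ∈ Finset.univ.erase i, (c.p m j - p' j) * Δ j)
    rw [h1, add_sub_cancel_right, ← h1] at h3
    linarith
  have hmain : ρ ^ 2 * (s ^ 3 * (t - 1)) ≤
      ρ ^ 2 * ((2 + d) * s ^ 4 + c.L * (t + 1) ^ 2) := by
    have : (ρ * s ^ 3) * (ρ * (t - 1)) ≤ |c.p m i - p' i| * |Δ i| :=
      mul_le_mul hi.le hlow (by have : 0 ≤ t - 1 := by linarith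
                                positivity) (abs_nonneg _)
    rw [← abs_mul] at this
    nlinarith
  have hmain2 := le_of_mul_le_mul_left hmain (by positivity)
  rw [lt_div_iff₀ (by positivity)] at ht
  have h3 : c.L * (t + 1) ^ 2 ≤ s ^ 3 * (t + 1) / 2 := by
    have : c.L * (t + 1) ≤ s ^ 3 / 2 := by nlinarith
    nlinarith
  have h4 : s ^ 3 * t ≤ s ^ 3 * (2 * (4 + d) * s) := by
    have : s ^ 3 ≤ s ^ 4 := pow_le_pow_right₀ hs (by norm_num)
    nlinarith
  exact le_of_mul_le_mul_left h4 (by positivity)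

lemma card_le_mul_card_image_real {α β : Type*} [DecidableEq β] (T : Finset α) (φ : α → β) (N : ℝ)
    (h : ∀ w ∈ T.image φ, ((T.filter fun k => φ k = w).card : ℝ) ≤ N) :
    (T.card : ℝ) ≤ N * (T.image φ).card := by
  rw [Finset.card_eq_sum_card_image φ T]
  push_cast
  refine (Finset.sum_le_card_nsmul _ _ N h).trans ?_
  rw [nsmul_eq_mul, mul_comm]

lemma card_slab_le (hd : 2 ≤ d) (c : Contact d M) :
    ∃ C > (0 : ℝ), ∀ (T : Finset (Fin d → ℤ)) (m : (Fin d → ℤ) → M) (ρ h s : ℝ) (p' : Fin d → ℝ)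
      (b : ℝ), 0 < ρ → 0 < h → 1 ≤ s →
      (∀ k ∈ T, ∀ j, ρ * k j ≤ c.y (m k) j ∧ c.y (m k) j ≤ ρ * (k j + 1)) →
      (∀ k ∈ T, ‖c.p (m k) - p'‖ ≤ ρ * s ^ 4) →
      (∀ k ∈ T, |b - h * (p' ⬝ᵥ c.y (m k)) + h * c.u (m k)| ≤ h * (ρ ^ 2 * s ^ 4)) →
      (T.card : ℝ) ≤ C * s ^ (4 * d - 2) := by
  classical
  have hL := c.one_le_L
  set L := c.L with hLdef
  refine ⟨(7 * L) ^ d + d * ((4 * (4 + d) + 1) * (27 * L ^ 2 * (7 * L) ^ (d - 1))), by positivity,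
    fun T m ρ h s p' b hρ hh hs hbox hΓ hψ => ?_⟩
  have hs0 : 0 < s := by linarith
  have hs3 : 1 ≤ s ^ 3 := one_le_pow₀ hs
  have hs4 : 1 ≤ s ^ 4 := one_le_pow₀ hs
  have hdist : ∀ k ∈ T, ∀ k' ∈ T, ∀ D : ℝ, ‖c.p (m k) - p'‖ ≤ ρ * D → ‖c.p (m k') - p'‖ ≤ ρ * D →
      ∀ j, |(k' j : ℝ) - k j| ≤ 2 * L * D + 1 := by
    intro k hk k' hk' D h1 h2 j
    have h3 := c.norm_y_sub_le (m k) (m k')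
    have h4 : ‖c.p (m k') - c.p (m k)‖ ≤ 2 * (ρ * D) := by
      rw [← sub_sub_sub_cancel_right _ _ p']
      exact (norm_sub_le _ _).trans (by linarith)
    have h5 := (norm_le_pi_norm (c.y (m k') - c.y (m k)) j).trans
      (h3.trans (mul_le_mul_of_nonneg_left h4 (by positivity)))
    rw [Real.norm_eq_abs, Pi.sub_apply] at h5
    have h6 : ρ * |(k' j : ℝ) - k j| ≤ ρ * (2 * L * D + 1) := by
      rw [← abs_of_pos hρ, ← abs_mul, abs_of_pos hρ]
      have h7 := hbox k hk j
      have h8 := hbox k' hk' j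
      rw [abs_le] at *
      constructor <;> nlinarith [h5.1, h5.2, h7.1, h7.2, h8.1, h8.2]
    exact le_of_mul_le_mul_left h6 hρ
  have hψ2 : ∀ k ∈ T, ∀ k' ∈ T, |c.u (m k') - c.u (m k) - p' ⬝ᵥ (c.y (m k') - c.y (m k))| ≤
      2 * (ρ ^ 2 * s ^ 4) := by
    intro k hk k' hk'
    have h1 := hψ k hk
    have h2 := hψ k' hk'
    refine le_of_mul_le_mul_left ?_ hh
    rw [← abs_of_pos hh, ← abs_mul, abs_of_pos hh]
    have : h * (c.u (m k') - c.u (m k) - p' ⬝ᵥ (c.y (m k') - c.y (m k))) =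
      (b - h * (p' ⬝ᵥ c.y (m k')) + h * c.u (m k')) -
        (b - h * (p' ⬝ᵥ c.y (m k)) + h * c.u (m k)) := by rw [dotProduct_sub]; ring
    rw [this]
    exact (abs_sub _ _).trans (by linarith)
  set T₁ := T.filter fun k => ‖c.p (m k) - p'‖ ≤ ρ * s ^ 3 with hT₁
  set T₂ : Fin d → Finset (Fin d → ℤ) := fun i =>
    T.filter fun k => ρ * s ^ 3 < |c.p (m k) i - p' i| with hT₂
  have hcover : T ⊆ T₁ ∪ Finset.univ.biUnion T₂ := by
    intro k hk
    by_cases h1 : ‖c.p (m k) - p'‖ ≤ ρ * s ^ 3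
    · exact Finset.mem_union_left _ (Finset.mem_filter.2 ⟨hk, h1⟩)
    · rw [pi_norm_le_iff_of_nonneg (by positivity)] at h1
      push Not at h1
      obtain ⟨i, hi⟩ := h1
      exact Finset.mem_union_right _ (Finset.mem_biUnion.2
        ⟨i, Finset.mem_univ _, Finset.mem_filter.2 ⟨hk, hi⟩⟩)
  have hcard : (T.card : ℝ) ≤ T₁.card + ∑ i, ((T₂ i).card : ℝ) := by
    have := (Finset.card_le_card hcover).trans ((Finset.card_union_le _ _).trans
      (Nat.add_le_add_left Finset.card_biUnion_le _))
    exact_mod_cast this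
  have hT₁card : (T₁.card : ℝ) ≤ (7 * L) ^ d * s ^ (4 * d - 2) := by
    rcases T₁.eq_empty_or_nonempty with he | ⟨k₀, hk₀⟩
    · rw [he]; simp; positivity
    have := card_le_of_box T₁ (fun j => (k₀ j : ℝ)) (fun _ => 3 * L * s ^ 3)
      (fun _ => by positivity) fun k hk j => by
        have h1 := Finset.mem_filter.1 hk
        have h2 := Finset.mem_filter.1 hk₀
        refine (hdist k₀ h2.1 k h1.1 (s ^ 3) h2.2 h1.2 j).trans ?_
        nlinarith
    refine this.trans ?_
    rw [Finset.prod_const, Finset.card_univ, Fintype.card_fin]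
    calc (2 * (3 * L * s ^ 3) + 1) ^ d ≤ (7 * L * s ^ 3) ^ d := by gcongr; nlinarith
      _ = (7 * L) ^ d * s ^ (3 * d) := by rw [mul_pow, ← pow_mul]
      _ ≤ _ := by gcongr; omega
  have hT₂card : ∀ i, ((T₂ i).card : ℝ) ≤
      (4 * (4 + d) + 1) * (27 * L ^ 2 * (7 * L) ^ (d - 1)) * s ^ (4 * d - 2) := by
    intro i
    rcases (T₂ i).eq_empty_or_nonempty with he | ⟨k₀, hk₀⟩
    · rw [he]; simp; positivity
    set ℓ := s ^ 3 / (4 * L) with hℓ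
    have hℓ0 : 0 < ℓ := by positivity
    set φ : (Fin d → ℤ) → Fin d → ℤ := fun k => Function.update k i ⌊(k i : ℝ) / ℓ⌋ with hφ
    have hfib : ∀ w ∈ (T₂ i).image φ, (((T₂ i).filter fun k => φ k = w).card : ℝ) ≤
        (4 * (4 + d) + 1) * s := by
      intro w hw
      obtain ⟨k₁, hk₁, rfl⟩ := Finset.mem_image.1 hw
      have h1 := Finset.mem_filter.1 hk₁
      have hmaps : ∀ k ∈ (T₂ i).filter fun k => φ k = φ k₁, k i ∈
          Finset.Icc ⌈(k₁ i : ℝ) - 2 * (4 + d) * s⌉ ⌊(k₁ i : ℝ) + 2 * (4 + d) * s⌋ := by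
        intro k hk
        obtain ⟨hk2, hk3⟩ := Finset.mem_filter.1 hk
        have h2 := Finset.mem_filter.1 hk2
        have hfl : ⌊(k i : ℝ) / ℓ⌋ = ⌊(k₁ i : ℝ) / ℓ⌋ := by
          have := congrFun hk3 i
          simpa [hφ] using this
        refine mem_Icc_ceil_floor (slab_line_bound c hρ hs (hbox k₁ h1.1) (hbox k h2.1)
          (hΓ _ h1.1) (hψ2 _ h1.1 _ h2.1) h1.2 (fun j hj => ?_) ?_)
        · have := congrFun hk3 j
          simpa [hφ, hj] using this
        · have := Int.abs_sub_lt_one_of_floor_eq_floor hfl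
          rw [← sub_div, abs_div, abs_of_pos hℓ0, div_lt_one hℓ0] at this
          exact this
      have := Finset.card_le_card_of_injOn
        (s := (T₂ i).filter fun k => φ k = φ k₁) (fun k : Fin d → ℤ => k i) hmaps ?_
      · calc _ ≤ ((Finset.Icc ⌈(k₁ i : ℝ) - 2 * (4 + d) * s⌉
              ⌊(k₁ i : ℝ) + 2 * (4 + d) * s⌋).card : ℝ) := by exact_mod_cast this
          _ ≤ _ := (card_Icc_ceil_floor_le _ _ (by positivity)).trans (by nlinarith)
      · intro k hk k' hk' hkk
        have h2 := (Finset.mem_filter.1 hk).2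
        have h3 := (Finset.mem_filter.1 hk').2
        ext j
        rcases eq_or_ne j i with rfl | hj
        · exact hkk
        · have h4 := congrFun h2 j
          have h5 := congrFun h3 j
          simp only [hφ, Function.update_of_ne hj] at h4 h5
          rw [h4, h5]
    have him : (((T₂ i).image φ).card : ℝ) ≤ 27 * L ^ 2 * s * (7 * L * s ^ 4) ^ (d - 1) := by
      have h0 := Finset.mem_filter.1 hk₀
      have := card_le_of_box ((T₂ i).image φ) (fun j => (φ k₀ j : ℝ))
        (fun j => if j = i then 13 * L ^ 2 * s else 3 * L * s ^ 4)
        (fun j => by split_ifs <;> positivity) ?_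
      · refine this.trans ?_
        rw [← Finset.mul_prod_erase _ _ (Finset.mem_univ i), if_pos rfl]
        refine mul_le_mul ?_ ?_ (Finset.prod_nonneg fun j _ => by split_ifs <;> positivity)
          (by positivity)
        · nlinarith
        · refine (Finset.prod_le_prod (g := fun _ => 7 * L * s ^ 4)
            (fun j _ => by split_ifs <;> positivity) fun j hj => ?_).trans ?_
          · rw [if_neg (Finset.ne_of_mem_erase hj)]; nlinarith
          · rw [Finset.prod_const, Finset.card_erase_of_mem (Finset.mem_univ i)]; simp
      · intro w hw j
        obtain ⟨k, hk, rfl⟩ := Finset.mem_image.1 hw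
        have h1 := Finset.mem_filter.1 hk
        have h2 := hdist k₀ h0.1 k h1.1 (s ^ 4) (hΓ _ h0.1) (hΓ _ h1.1) j
        have h3 : |(k j : ℝ) - k₀ j| ≤ 3 * L * s ^ 4 := by nlinarith
        split_ifs with hj
        · subst hj
          simp only [hφ, Function.update_self]
          have h4 : |(k j : ℝ) / ℓ - k₀ j / ℓ| ≤ 12 * L ^ 2 * s := by
            rw [← sub_div, abs_div, abs_of_pos hℓ0, div_le_iff₀ hℓ0, hℓ]
            refine h3.trans (le_of_eq ?_)
            field_simp
            ring
          have h5 := Int.floor_le ((k j : ℝ) / ℓ)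
          have h6 := Int.lt_floor_add_one ((k j : ℝ) / ℓ)
          have h7 := Int.floor_le ((k₀ j : ℝ) / ℓ)
          have h8 := Int.lt_floor_add_one ((k₀ j : ℝ) / ℓ)
          have h9 : 1 ≤ L ^ 2 * s := one_le_mul_of_one_le_of_one_le (one_le_pow₀ hL) hs
          rw [abs_le] at *
          constructor <;> linarith [h4.1, h4.2]
        · simpa [hφ, hj] using h3
    have := card_le_mul_card_image_real (T₂ i) φ _ hfib
    refine this.trans ((mul_le_mul_of_nonneg_left him (by positivity)).trans (le_of_eq ?_))
    have e : s ^ (4 * d - 2) = s * s * (s ^ 4) ^ (d - 1) := by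
      rw [← pow_mul, ← pow_two, ← pow_add]; congr 1; omega
    rw [e, mul_pow (7 * L)]
    ring
  calc (T.card : ℝ) ≤ T₁.card + ∑ i, ((T₂ i).card : ℝ) := hcard
    _ ≤ (7 * L) ^ d * s ^ (4 * d - 2) + ∑ i : Fin d,
        (4 * (4 + d) + 1) * (27 * L ^ 2 * (7 * L) ^ (d - 1)) * s ^ (4 * d - 2) := by
      gcongr with i; exact hT₂card i
    _ = _ := by rw [Finset.sum_const, Finset.card_univ, Fintype.card_fin, nsmul_eq_mul]; ring

end Slab

section Recursion

variable {ι : Type*} [Fintype ι] {d : ℕ} {M : Type*}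

/-- The constants of the recursion are compatible with the contact family `c`. -/
structure Params (c : Contact d M) (h₀ e r g D : ℝ) : Prop where
  h₀_pos : 0 < h₀
  e_pos : 0 < e
  h₀_le : 5 * d * c.B ^ 2 * h₀ ≤ 1
  e_le_sq : e ≤ h₀ ^ 2
  e_le_half : e ≤ 1 / 2
  e_le_ε : e ≤ c.ε * h₀
  e_le_L : 32 * c.L ^ 3 * e ≤ h₀
  e_le_d : 3 * (d + 2 + c.L) * e ≤ 1
  g_eq : g = 32 * c.L * e
  r_le : r + g / h₀ ≤ c.R
  one_le_D : 1 ≤ D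

lemma Params.swap {c : Contact d M} {h₀ e r g D : ℝ} (P : Params c h₀ e r g D) :
    Params c.swap h₀ e r g D :=
  ⟨P.h₀_pos, P.e_pos, P.h₀_le, P.e_le_sq, P.e_le_half, P.e_le_ε, P.e_le_L, P.e_le_d, P.g_eq,
    P.r_le, P.one_le_D⟩

/-- The lattice point `z` has denominator in `[h₀, Q]` and height within `δ` of the hypersurface,
over a point of radius at most `r`. -/
def Near (V : (ι → ℝ) ≃ₗ[ℝ] Amb d) (c : Contact d M) (h₀ r Q δ : ℝ) (z : ι → ℤ) : Prop :=
  h₀ ≤ (lat V z).1 ∧ (lat V z).1 ≤ Q ∧ ∃ m, c.rad m ≤ r ∧ (lat V z).2.1 = (lat V z).1 • c.y m ∧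
    |(lat V z).2.2 - (lat V z).1 * c.u m| ≤ δ

/-- The counting bound for denominators up to `Q₀`. -/
def Bound (V : (ι → ℝ) ≃ₗ[ℝ] Amb d) (c : Contact d M) (h₀ r g D Q₀ A a : ℝ) : Prop :=
  ∀ (Q δ : ℝ) (F : Finset (ι → ℤ)), h₀ ≤ Q → Q ≤ Q₀ → 0 < δ → δ ≤ D →
    (∀ z ∈ F, Near V c h₀ (r + g / Q) Q δ z) →
      (F.card : ℝ) ≤ A * δ * Q ^ (d + 1) + a * Q ^ d

/-- The dual lattice point `w` lies in the body dual to the contact element `m`. -/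
def DualNear (V : (ι → ℝ) ≃ₗ[ℝ] Amb d) (c : Contact d M) (h₀ e Q lam : ℝ) (m : M)
    (w : ι → ℤ) : Prop :=
  h₀ ≤ (lat (dual V) w).1 ∧ (lat (dual V) w).1 ≤ e * Q / lam ^ 2 ∧
    ‖(lat (dual V) w).2.1 - (lat (dual V) w).1 • c.p m‖ ≤ e / lam ∧
    |(lat (dual V) w).2.2 - (lat (dual V) w).2.1 ⬝ᵥ c.y m + (lat (dual V) w).1 * c.u m| ≤ e / Q

/-- A nonzero dual lattice point in the dual body has denominator at least `h₀`. -/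
lemma le_abs_of_ne_zero (hd : 2 ≤ d) {V : (ι → ℝ) ≃ₗ[ℝ] Amb d} (hV : Isometric V)
    {c : Contact d M} {h₀ e r g D : ℝ} (P : Params c h₀ e r g D) {Q lam : ℝ} {m : M} {w : ι → ℤ}
    (hQ : h₀ ≤ Q) (hlam : 1 ≤ lam) (hw : w ≠ 0)
    (h2 : ‖(lat V w).2.1 - (lat V w).1 • c.p m‖ ≤ e / lam)
    (h3 : |(lat V w).2.2 - (lat V w).2.1 ⬝ᵥ c.y m + (lat V w).1 * c.u m| ≤ e / Q) :
    h₀ ≤ |(lat V w).1| := by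
  by_contra! h1
  have h4 := hV.one_le hw
  generalize lat V w = x at *
  have hh := P.h₀_pos
  have hB := c.one_le_B
  have hdR : (2 : ℝ) ≤ d := by exact_mod_cast hd
  have hh1 : h₀ ≤ 1 := by
    have := P.h₀_le
    have : 1 ≤ 5 * d * c.B ^ 2 := by nlinarith [one_le_pow₀ hB (n := 2)]
    nlinarith
  have e1 : e / lam ≤ h₀ := (div_le_self P.e_pos.le hlam).trans (P.e_le_sq.trans (by nlinarith))
  have e2 : e / Q ≤ h₀ := by
    rw [div_le_iff₀ (by linarith)]; nlinarith [P.e_le_sq]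
  have ha : ‖x.2.1‖ ≤ 2 * c.B * h₀ := by
    have h5 := norm_add_le (x.2.1 - x.1 • c.p m) (x.1 • c.p m)
    rw [sub_add_cancel, norm_smul, Real.norm_eq_abs] at h5
    have h6 : |x.1| * ‖c.p m‖ ≤ h₀ * c.B := by
      gcongr; exact c.norm_p_le m
    nlinarith
  have hb : |x.2.2| ≤ 4 * d * c.B ^ 2 * h₀ := by
    have h5 : |x.2.1 ⬝ᵥ c.y m| ≤ d * (2 * c.B * h₀ * c.B) := by
      refine (abs_dotProduct_le _ _).trans ?_
      gcongr; exact c.norm_y_le m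
    have h6 : |x.1 * c.u m| ≤ h₀ * c.B := by
      rw [abs_mul]; gcongr; exact c.abs_u_le m
    have h7 : |x.2.2| ≤ h₀ + d * (2 * c.B * h₀ * c.B) + h₀ * c.B := by
      rw [abs_le] at *; constructor <;> linarith [h3.1, h3.2, h5.1, h5.2, h6.1, h6.2]
    refine h7.trans ?_
    have h8 : c.B ≤ c.B ^ 2 := by nlinarith
    have h9 : 2 * c.B ^ 2 ≤ d * c.B ^ 2 := by gcongr
    have h10 : 1 + c.B ≤ 2 * d * c.B ^ 2 := by nlinarith
    nlinarith
  have h5 : x.2.1 ⬝ᵥ x.2.1 ≤ d * (2 * c.B * h₀) ^ 2 := by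
    refine (le_abs_self _).trans ((abs_dotProduct_le _ _).trans ?_)
    rw [← pow_two]; gcongr
  have h6 : x.1 * x.1 ≤ h₀ ^ 2 := by rw [← abs_mul_abs_self, ← pow_two]; gcongr
  have h7 : x.2.2 * x.2.2 ≤ (4 * d * c.B ^ 2 * h₀) ^ 2 := by
    rw [← abs_mul_abs_self, ← pow_two]; gcongr
  have h8 : (5 * d * c.B ^ 2 * h₀) ^ 2 ≤ 1 := by
    have := P.h₀_le
    exact pow_le_one₀ (by positivity) this
  have h9 : c.B ^ 2 ≤ c.B ^ 4 := pow_le_pow_right₀ hB (by norm_num)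
  have h10 : 1 ≤ c.B ^ 4 := one_le_pow₀ hB
  have h11 : 4 * d * c.B ^ 2 ≤ 2 * d ^ 2 * c.B ^ 4 := by nlinarith [mul_nonneg (by linarith : (0:ℝ) ≤ d) (by positivity : 0 ≤ c.B ^ 4)]
  have h12 : 1 ≤ d ^ 2 * c.B ^ 4 := by nlinarith
  unfold ip at h4
  have h13 : (1 : ℝ) ≤ h₀ ^ 2 * (1 + 4 * d * c.B ^ 2 + 16 * (d ^ 2 * c.B ^ 4)) := by nlinarith
  have h14 : h₀ ^ 2 * (1 + 4 * d * c.B ^ 2 + 16 * (d ^ 2 * c.B ^ 4)) ≤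
    h₀ ^ 2 * (19 * (d ^ 2 * c.B ^ 4)) := by gcongr; nlinarith
  have h15 : h₀ ^ 2 * (25 * (d ^ 2 * c.B ^ 4)) ≤ 1 := by nlinarith
  have h16 : 0 < h₀ ^ 2 * (d ^ 2 * c.B ^ 4) := by positivity
  linarith

/-- Counting the lattice points over one cell by dual lattice points. -/
lemma exists_card_cell_le (hd : 2 ≤ d) {V : (ι → ℝ) ≃ₗ[ℝ] Amb d} (hV : Isometric V)
    {c : Contact d M} {h₀ e r g D : ℝ} (P : Params c h₀ e r g D) :
    ∃ K > (0 : ℝ), ∀ (m : M) (Q lam : ℝ) (F : Finset (ι → ℤ)), h₀ ≤ Q → 1 ≤ lam →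
      (∀ z ∈ F, |(lat V z).1| ≤ Q ∧ ‖(lat V z).2.1 - (lat V z).1 • c.y m‖ ≤ lam ∧
        |(lat V z).2.2 - (lat V z).1 * c.u m - ((lat V z).2.1 - (lat V z).1 • c.y m) ⬝ᵥ c.p m|
          ≤ (1 + c.L) * lam ^ 2 / Q) →
      ∃ W : Finset (ι → ℤ), (∀ w ∈ W, DualNear V c h₀ e Q lam m w) ∧
        (F.card : ℝ) ≤ K * lam ^ (d + 2) * (1 + 2 * W.card) := by
  classical
  obtain ⟨K, hK, hmain⟩ := exists_dual_finset V hV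
  have he := P.e_pos
  refine ⟨K / (e / 2) ^ (d + 2), by positivity, fun m Q lam F hQ hlam hF => ?_⟩
  have hQ0 : 0 < Q := P.h₀_pos.trans_le hQ
  have hl0 : 0 < lam := by linarith
  obtain ⟨W, hW, hcard⟩ := hmain (c.y m) (c.p m) (c.u m) Q lam ((1 + c.L) * lam ^ 2 / Q)
    (e / 2 / Q) (e / 2 / lam) (e / 2 * Q / lam ^ 2) F (by positivity) (by positivity)
    (by positivity) (by
      have := P.e_le_d
      have e1 : e / 2 / Q * Q + d * (e / 2 / lam * lam) +
        e / 2 * Q / lam ^ 2 * ((1 + c.L) * lam ^ 2 / Q) = e / 2 * (d + 2 + c.L) := by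
          field_simp; ring
      rw [e1]; linarith) hF
  set W' := (W ∪ W.image (fun w => -w)).filter fun w => h₀ ≤ (lat (dual V) w).1 with hW'
  have hWe : ∀ w ∈ W, |(lat (dual V) w).1| ≤ e * Q / lam ^ 2 ∧
      ‖(lat (dual V) w).2.1 - (lat (dual V) w).1 • c.p m‖ ≤ e / lam ∧
      |(lat (dual V) w).2.2 - (lat (dual V) w).2.1 ⬝ᵥ c.y m + (lat (dual V) w).1 * c.u m|
        ≤ e / Q := by
    intro w hw
    obtain ⟨h1, h2, h3⟩ := hW w hw
    refine ⟨h1.trans (le_of_eq (by ring)), h2.trans (le_of_eq (by ring)),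
      h3.trans (le_of_eq (by ring))⟩
  refine ⟨W', fun w hw => ?_, ?_⟩
  · obtain ⟨hw1, hw2⟩ := Finset.mem_filter.1 hw
    rcases Finset.mem_union.1 hw1 with hw3 | hw3
    · obtain ⟨h1, h2, h3⟩ := hWe w hw3
      exact ⟨hw2, (le_abs_self _).trans h1, h2, h3⟩
    · obtain ⟨w', hw4, rfl⟩ := Finset.mem_image.1 hw3
      obtain ⟨h1, h2, h3⟩ := hWe w' hw4
      unfold DualNear
      rw [lat_neg] at hw2 ⊢
      refine ⟨hw2, (le_abs_self _).trans ?_, ?_, ?_⟩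
      · rw [Prod.fst_neg, abs_neg]; exact h1
      · refine le_trans (le_of_eq ?_) h2
        rw [Prod.fst_neg, Prod.snd_neg, Prod.fst_neg, ← norm_neg]
        congr 1; module
      · refine le_trans (le_of_eq ?_) h3
        rw [Prod.fst_neg, Prod.snd_neg, Prod.fst_neg, Prod.snd_neg, ← abs_neg, neg_dotProduct]
        congr 1; ring
  · have hsub : W ⊆ {0} ∪ (W' ∪ W'.image fun w => -w) := by
      intro w hw
      by_cases h0 : w = 0
      · simp [h0]
      obtain ⟨h1, h2, h3⟩ := hWe w hw
      have h4 := le_abs_of_ne_zero hd hV.dual P hQ hlam h0 h2 h3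
      refine Finset.mem_union_right _ ?_
      rcases le_abs.1 h4 with h5 | h5
      · exact Finset.mem_union_left _ (Finset.mem_filter.2 ⟨Finset.mem_union_left _ hw, h5⟩)
      · refine Finset.mem_union_right _ (Finset.mem_image.2 ⟨-w, Finset.mem_filter.2
          ⟨Finset.mem_union_right _ (Finset.mem_image_of_mem _ hw), ?_⟩, neg_neg w⟩)
        rw [lat_neg]; exact h5
    have hWc : (W.card : ℝ) ≤ 1 + 2 * W'.card := by
      have h5 := Finset.card_le_card hsub
      have h6 := Finset.card_union_le {0} (W' ∪ W'.image fun w => -w)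
      have h7 := Finset.card_union_le W' (W'.image fun w => -w)
      have h8 := Finset.card_image_le (s := W') (f := fun w => -w)
      rw [Finset.card_singleton] at h6
      have : W.card ≤ 1 + 2 * W'.card := by omega
      exact_mod_cast this
    have e2 : e / 2 / Q * (e / 2 / lam) ^ d * (e / 2 * Q / lam ^ 2) =
        (e / 2) ^ (d + 2) / lam ^ (d + 2) := by
      rw [div_pow]; field_simp; ring
    rw [e2] at hcard
    calc (F.card : ℝ) = F.card * ((e / 2) ^ (d + 2) / lam ^ (d + 2)) *
          (lam ^ (d + 2) / (e / 2) ^ (d + 2)) := by field_simp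
      _ ≤ K * (1 + 2 * W'.card) * (lam ^ (d + 2) / (e / 2) ^ (d + 2)) := by
          refine mul_le_mul_of_nonneg_right (hcard.trans ?_) (by positivity)
          gcongr
      _ = _ := by ring

end Recursion

section Recursion

variable {ι : Type*} {d : ℕ} {M : Type*}

/-- A point of the dual body is a dual lattice point close to the dual hypersurface. -/
lemma DualNear.near {V : (ι → ℝ) ≃ₗ[ℝ] Amb d}
    {c : Contact d M} {h₀ e r g D : ℝ} (P : Params c h₀ e r g D) {Q lam H : ℝ} {m : M} {w : ι → ℤ}
    (hQ : h₀ ≤ Q) (hlam : 1 ≤ lam) (hm : c.rad m ≤ r + g / Q)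
    (hw : DualNear V c h₀ e Q lam m w) (hH : H ≤ e * Q / lam ^ 2)
    (hwH : (lat (dual V) w).1 ≤ H) (hHw : H < 16 * (lat (dual V) w).1) :
    Near (dual V) c.swap h₀ (r + g / H) H (32 * c.L ^ 3 * e ^ 2 / (lam ^ 2 * H)) w := by
  obtain ⟨w1, w2, w3, w4⟩ := hw
  unfold Near
  generalize lat (dual V) w = x at *
  have hL := c.one_le_L
  have he := P.e_pos
  have hh := P.h₀_pos
  have hx : 0 < x.1 := hh.trans_le w1
  have hl0 : 0 < lam := by linarith
  have hQ0 : 0 < Q := hh.trans_le hQ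
  have hH0 : 0 < H := hx.trans_le hwH
  have hg : 0 < g := by rw [P.g_eq]; positivity
  set p' : Fin d → ℝ := x.1⁻¹ • x.2.1 with hp'
  have hxp : x.2.1 = x.1 • p' := by rw [hp', smul_smul, mul_inv_cancel₀ hx.ne', one_smul]
  have hΓ : ‖p' - c.p m‖ ≤ e / (lam * x.1) := by
    have : ‖x.1 • (p' - c.p m)‖ ≤ e / lam := by rw [smul_sub, ← hxp]; exact w3
    rw [norm_smul, Real.norm_of_nonneg hx.le] at this
    rw [← div_div, le_div_iff₀ hx, mul_comm]; exact this
  have hrad : c.rad m ≤ c.R := by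
    refine hm.trans (le_trans ?_ P.r_le)
    gcongr
  obtain ⟨m', hm'⟩ := c.surj_p m hrad p' (by
    refine hΓ.trans ?_
    rw [div_le_iff₀ (by positivity)]
    refine P.e_le_ε.trans ?_
    have := c.ε_pos
    gcongr
    nlinarith)
  refine ⟨w1, hwH, m', ?_, by rw [hxp, ← hm']; rfl, ?_⟩
  · have h1 := c.rad_le_p m m'
    rw [hm'] at h1
    have h2 : c.L * ‖p' - c.p m‖ ≤ 16 * c.L * e / H := by
      calc c.L * ‖p' - c.p m‖ ≤ c.L * (e / (lam * x.1)) := by gcongr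
        _ ≤ c.L * (e / (1 * (H / 16))) := by gcongr; linarith
        _ = _ := by field_simp
    have h3 : g / Q ≤ g / H / 2 := by
      rw [div_div]
      gcongr
      have : e * Q / lam ^ 2 ≤ e * Q := div_le_self (by positivity) (one_le_pow₀ hlam)
      nlinarith [P.e_le_half]
    have h4 : g / H / 2 = 16 * c.L * e / H := by rw [P.g_eq]; ring
    have h5 : g / H = g / H / 2 + g / H / 2 := by ring
    change c.rad m' ≤ _
    linarith
  · change |x.2.2 - x.1 * c.v m'| ≤ _
    have h1 := c.taylor_u m' m
    have h2 := c.norm_y_sub_le m' m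
    rw [norm_sub_rev (c.p m), hm'] at h2
    have hv : c.v m' = c.y m' ⬝ᵥ p' - c.u m' := by rw [← hm', ← c.add_eq]; ring
    have h3 : x.2.2 - x.1 * c.v m' = (x.2.2 - x.2.1 ⬝ᵥ c.y m + x.1 * c.u m) -
        x.1 * (c.u m - c.u m' - c.p m' ⬝ᵥ (c.y m - c.y m')) := by
      rw [hv, hm', hxp, smul_dotProduct, dotProduct_sub, dotProduct_comm (c.y m'), smul_eq_mul]
      ring
    have h4 : |x.1 * (c.u m - c.u m' - c.p m' ⬝ᵥ (c.y m - c.y m'))| ≤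
        x.1 * (c.L * (c.L * (e / (lam * x.1))) ^ 2) := by
      rw [abs_mul, abs_of_pos hx]
      gcongr
      refine h1.trans ?_
      gcongr
      exact h2.trans (by gcongr)
    have h5 : x.1 * (c.L * (c.L * (e / (lam * x.1))) ^ 2) = c.L ^ 3 * e ^ 2 / (lam ^ 2 * x.1) := by
      field_simp
    have h6 : e / Q ≤ c.L ^ 3 * e ^ 2 / (lam ^ 2 * x.1) := by
      have h7 : 1 ≤ c.L ^ 3 := one_le_pow₀ hL
      rw [le_div_iff₀ (by positivity)] at w2
      rw [div_le_div_iff₀ hQ0 (by positivity)]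
      calc e * (lam ^ 2 * x.1) ≤ 1 * (e * (e * Q)) := by
            linarith [mul_le_mul_of_nonneg_left w2 he.le]
        _ ≤ c.L ^ 3 * (e * (e * Q)) := by gcongr
        _ = _ := by ring
    rw [h3]
    refine (abs_sub _ _).trans ?_
    have h8 : c.L ^ 3 * e ^ 2 / (lam ^ 2 * x.1) ≤ c.L ^ 3 * e ^ 2 / (lam ^ 2 * (H / 16)) := by
      gcongr; linarith
    have h9 : 32 * c.L ^ 3 * e ^ 2 / (lam ^ 2 * H) =
        c.L ^ 3 * e ^ 2 / (lam ^ 2 * (H / 16)) + c.L ^ 3 * e ^ 2 / (lam ^ 2 * (H / 16)) := by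
      field_simp; ring
    linarith

variable [Fintype ι]

/-- The dual points seen from all cells, counted with multiplicity. -/
lemma exists_sum_card_le (hd : 2 ≤ d) (V : (ι → ℝ) ≃ₗ[ℝ] Amb d)
    {c : Contact d M} {h₀ e r g D : ℝ} (P : Params c h₀ e r g D) :
    ∃ C > (0 : ℝ), ∀ (A a Q₁ Q lam : ℝ) (T : Finset (Fin d → ℤ)) (m : (Fin d → ℤ) → M)
      (W : (Fin d → ℤ) → Finset (ι → ℤ)), 0 ≤ A → 0 ≤ a →
      Bound (dual V) c.swap h₀ r g D Q₁ A a → h₀ ≤ Q → 1 ≤ lam → e * Q / lam ^ 2 ≤ Q₁ →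
      (∀ k ∈ T, ∀ j, lam / Q * k j ≤ c.y (m k) j ∧ c.y (m k) j ≤ lam / Q * (k j + 1)) →
      (∀ k ∈ T, c.rad (m k) ≤ r + g / Q) →
      (∀ k ∈ T, ∀ w ∈ W k, DualNear V c h₀ e Q lam (m k) w) →
      ∑ k ∈ T, ((W k).card : ℝ) ≤ C * (Q / lam ^ 2) ^ d * (A / lam ^ 2 + a) := by
  classical
  obtain ⟨Cs, hCs, hslab⟩ := card_slab_le hd c
  have hL := c.one_le_L
  have hL3 : 1 ≤ c.L ^ 3 := one_le_pow₀ hL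
  have he := P.e_pos
  have hh := P.h₀_pos
  set s₀ : ℝ := 16 / e with hs₀
  have hs₀1 : 1 ≤ s₀ := by
    rw [hs₀, one_le_div he]; linarith [P.e_le_half]
  refine ⟨64 * c.L ^ 3 * (Cs * s₀ ^ (4 * d - 2)), by positivity,
    fun A a Q₁ Q lam T m W hA ha hbound hQ hlam hQ₁ hbox hrad hW => ?_⟩
  have hQ0 : 0 < Q := hh.trans_le hQ
  have hl0 : 0 < lam := by linarith
  set X := e * Q / lam ^ 2 with hX
  have hX0 : 0 < X := by positivity
  set Ξ := T.biUnion W with hΞ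
  have hΞh : ∀ w ∈ Ξ, h₀ ≤ (lat (dual V) w).1 ∧ (lat (dual V) w).1 ≤ X := by
    intro w hw
    obtain ⟨k, hk, hwk⟩ := Finset.mem_biUnion.1 hw
    obtain ⟨h1, h2, -, -⟩ := hW k hk w hwk
    exact ⟨h1, h2⟩
  have hidx : ∀ w : ι → ℤ, ∃ n : ℕ, w ∈ Ξ →
      (lat (dual V) w).1 ≤ X / 16 ^ n ∧ X / 16 ^ n < 16 * (lat (dual V) w).1 := by
    intro w
    by_cases hw : w ∈ Ξ
    · obtain ⟨h1, h2⟩ := hΞh w hw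
      have h3 : 0 < (lat (dual V) w).1 := hh.trans_le h1
      obtain ⟨n, hn1, hn2⟩ := exists_nat_pow_near (x := X / (lat (dual V) w).1) (y := 16)
        ((one_le_div h3).2 h2) (by norm_num)
      refine ⟨n, fun _ => ⟨?_, ?_⟩⟩
      · rw [le_div_iff₀ (by positivity)]
        rw [le_div_iff₀ h3] at hn1
        linarith
      · rw [div_lt_iff₀ (by positivity)]
        rw [div_lt_iff₀ h3, pow_succ] at hn2
        linarith
    · exact ⟨0, fun h => absurd h hw⟩
  choose idx hidx using hidx
  have hfibre : ∀ n, ((Ξ.filter fun w => idx w = n).card : ℝ) ≤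
      32 * c.L ^ 3 * (A / lam ^ 2 + a) * (X / 16 ^ n) ^ d := by
    intro n
    rcases (Ξ.filter fun w => idx w = n).eq_empty_or_nonempty with hem | ⟨w₀, hw₀⟩
    · rw [hem]; simp; positivity
    set H := X / 16 ^ n with hH
    have hH0 : 0 < H := by positivity
    have hHX : H ≤ X := div_le_self hX0.le (one_le_pow₀ (by norm_num))
    have hh₀H : h₀ ≤ H := by
      obtain ⟨h1, rfl⟩ := Finset.mem_filter.1 hw₀
      exact (hΞh w₀ h1).1.trans (hidx w₀ h1).1
    have hη : 32 * c.L ^ 3 * e ^ 2 / (lam ^ 2 * H) ≤ D := by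
      refine le_trans ?_ P.one_le_D
      rw [div_le_one (by positivity)]
      have h1 : (1 : ℝ) ≤ lam ^ 2 := one_le_pow₀ hlam
      calc 32 * c.L ^ 3 * e ^ 2 = 32 * c.L ^ 3 * e * e := by ring
        _ ≤ h₀ * 1 := by
          have := P.e_le_half
          exact mul_le_mul P.e_le_L (by linarith) he.le hh.le
        _ ≤ H * lam ^ 2 := by gcongr
        _ = _ := by ring
    have h1 := hbound H (32 * c.L ^ 3 * e ^ 2 / (lam ^ 2 * H)) (Ξ.filter fun w => idx w = n)
      hh₀H (hHX.trans hQ₁) (by positivity) hη (fun w hw => by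
        obtain ⟨hw1, rfl⟩ := Finset.mem_filter.1 hw
        obtain ⟨k, hk, hwk⟩ := Finset.mem_biUnion.1 hw1
        exact (hW k hk w hwk).near P hQ hlam (hrad k hk) hHX (hidx w hw1).1 (hidx w hw1).2)
    refine h1.trans ?_
    have e1 : A * (32 * c.L ^ 3 * e ^ 2 / (lam ^ 2 * H)) * H ^ (d + 1) + a * H ^ d =
        (32 * c.L ^ 3 * (e ^ 2 * (A / lam ^ 2)) + a) * H ^ d := by
      field_simp
      ring
    rw [e1]
    gcongr
    have h2 : e ^ 2 ≤ 1 := pow_le_one₀ he.le (by linarith [P.e_le_half])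
    have h3 : e ^ 2 * (A / lam ^ 2) ≤ 1 * (A / lam ^ 2) := by gcongr
    have h4 : 1 * a ≤ 32 * c.L ^ 3 * a := by gcongr; linarith
    have h5 : 32 * c.L ^ 3 * (e ^ 2 * (A / lam ^ 2)) ≤ 32 * c.L ^ 3 * (1 * (A / lam ^ 2)) := by
      gcongr
    linarith
  have hmult : ∀ w ∈ Ξ, ((T.filter fun k => w ∈ W k).card : ℝ) ≤
      Cs * (s₀ * 2 ^ idx w) ^ (4 * d - 2) := by
    intro w hw
    obtain ⟨hw1, hw2⟩ := hΞh w hw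
    obtain ⟨hi1, hi2⟩ := hidx w hw
    set n := idx w
    set x := lat (dual V) w with hx
    have hx0 : 0 < x.1 := hh.trans_le hw1
    have hs1 : 1 ≤ s₀ * 2 ^ n := one_le_mul_of_one_le_of_one_le hs₀1 (one_le_pow₀ (by norm_num))
    have hs4 : 16 ^ n * s₀ ≤ (s₀ * 2 ^ n) ^ 4 := by
      have e1 : ((2 : ℝ) ^ n) ^ 4 = 16 ^ n := by rw [← pow_mul, mul_comm, pow_mul]; norm_num
      rw [mul_pow, e1, mul_comm]
      gcongr
      exact le_self_pow₀ hs₀1 (by norm_num)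
    have hkey : Q ≤ lam ^ 2 * x.1 * (s₀ * 2 ^ n) ^ 4 := by
      refine le_trans ?_ (mul_le_mul_of_nonneg_left hs4 (by positivity))
      rw [div_lt_iff₀ (by positivity), hX, div_lt_iff₀ (by positivity)] at hi2
      have : lam ^ 2 * x.1 * (16 ^ n * s₀) = 16 * x.1 * 16 ^ n * lam ^ 2 / e := by
        rw [hs₀]; field_simp
      rw [this, le_div_iff₀ he]; linarith
    have hxp : x.2.1 = x.1 • (x.1⁻¹ • x.2.1) := by
      rw [smul_smul, mul_inv_cancel₀ hx0.ne', one_smul]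
    refine hslab (T.filter fun k => w ∈ W k) m (lam / Q) x.1 (s₀ * 2 ^ n) (x.1⁻¹ • x.2.1) x.2.2
      (by positivity) hx0 hs1 (fun k hk => hbox k (Finset.mem_filter.1 hk).1) ?_ ?_
    · intro k hk
      obtain ⟨hk1, hk2⟩ := Finset.mem_filter.1 hk
      obtain ⟨-, -, h3, -⟩ := hW k hk1 w hk2
      have h4 : ‖x.1 • (x.1⁻¹ • x.2.1 - c.p (m k))‖ ≤ e / lam := by
        rw [smul_sub, ← hxp]; exact h3
      rw [norm_smul, Real.norm_of_nonneg hx0.le, le_div_iff₀ hl0] at h4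
      rw [norm_sub_rev, div_mul_eq_mul_div, le_div_iff₀ hQ0]
      calc ‖x.1⁻¹ • x.2.1 - c.p (m k)‖ * Q
          ≤ ‖x.1⁻¹ • x.2.1 - c.p (m k)‖ * (lam ^ 2 * x.1 * (s₀ * 2 ^ n) ^ 4) := by gcongr
        _ = (x.1 * ‖x.1⁻¹ • x.2.1 - c.p (m k)‖ * lam) * (lam * (s₀ * 2 ^ n) ^ 4) := by ring
        _ ≤ 1 * (lam * (s₀ * 2 ^ n) ^ 4) := by
            gcongr; linarith [P.e_le_half]
        _ = _ := one_mul _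
    · intro k hk
      obtain ⟨hk1, hk2⟩ := Finset.mem_filter.1 hk
      obtain ⟨-, -, -, h3⟩ := hW k hk1 w hk2
      have h4 : x.1 * ((x.1⁻¹ • x.2.1) ⬝ᵥ c.y (m k)) = x.2.1 ⬝ᵥ c.y (m k) := by
        conv_rhs => rw [hxp]
        rw [smul_dotProduct x.1, smul_eq_mul]
      rw [h4]
      refine h3.trans ?_
      have h5 : x.1 * ((lam / Q) ^ 2 * (s₀ * 2 ^ n) ^ 4) =
          lam ^ 2 * x.1 * (s₀ * 2 ^ n) ^ 4 / Q / Q := by field_simp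
      rw [h5]
      gcongr
      refine le_trans ?_ ((one_le_div hQ0).2 hkey)
      linarith [P.e_le_half]
  have hdouble : ∑ k ∈ T, ((W k).card : ℝ) = ∑ w ∈ Ξ, ((T.filter fun k => w ∈ W k).card : ℝ) := by
    have h1 := Finset.sum_card_bipartiteAbove_eq_sum_card_bipartiteBelow
      (s := T) (t := Ξ) (fun k w => w ∈ W k)
    have h2 : ∀ k ∈ T, Ξ.bipartiteAbove (fun k w => w ∈ W k) k = W k := by
      intro k hk
      ext w
      rw [Finset.mem_bipartiteAbove]
      exact ⟨fun h => h.2, fun h => ⟨Finset.mem_biUnion.2 ⟨k, hk, h⟩, h⟩⟩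
    rw [Finset.sum_congr rfl fun k hk => by rw [h2 k hk]] at h1
    exact_mod_cast h1
  rw [hdouble]
  calc ∑ w ∈ Ξ, ((T.filter fun k => w ∈ W k).card : ℝ)
      ≤ ∑ w ∈ Ξ, Cs * (s₀ * 2 ^ idx w) ^ (4 * d - 2) := Finset.sum_le_sum hmult
    _ = ∑ n ∈ Ξ.image idx, ((Ξ.filter fun w => idx w = n).card : ℝ) *
          (Cs * (s₀ * 2 ^ n) ^ (4 * d - 2)) := by
        rw [Finset.sum_comp (fun n : ℕ => Cs * (s₀ * 2 ^ n) ^ (4 * d - 2)) idx]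
        simp only [nsmul_eq_mul]
    _ ≤ ∑ n ∈ Ξ.image idx, 32 * c.L ^ 3 * (A / lam ^ 2 + a) * X ^ d *
          (Cs * s₀ ^ (4 * d - 2)) * (1 / 4) ^ n := by
        refine Finset.sum_le_sum fun n _ => ?_
        refine (mul_le_mul_of_nonneg_right (hfibre n) (by positivity)).trans (le_of_eq ?_)
        have e1 : ((2 : ℝ) ^ n) ^ (4 * d - 2) * 4 ^ n = (16 ^ n) ^ d := by
          have e2 : (4 : ℝ) ^ n = (2 ^ n) ^ 2 := by rw [← pow_mul, mul_comm, pow_mul]; norm_num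
          have e3 : (16 : ℝ) ^ n = (2 ^ n) ^ 4 := by rw [← pow_mul, mul_comm, pow_mul]; norm_num
          rw [e2, e3, ← pow_add, ← pow_mul ((2 : ℝ) ^ n) 4 d]
          congr 1; omega
        rw [div_pow, mul_pow s₀, ← e1, one_div, inv_pow]
        field_simp
    _ = 32 * c.L ^ 3 * (A / lam ^ 2 + a) * X ^ d * (Cs * s₀ ^ (4 * d - 2)) *
          ∑ n ∈ Ξ.image idx, (1 / 4 : ℝ) ^ n := by rw [← Finset.mul_sum]
    _ ≤ 32 * c.L ^ 3 * (A / lam ^ 2 + a) * (Q / lam ^ 2) ^ d * (Cs * s₀ ^ (4 * d - 2)) * 2 := by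
        have h1 : ∑ n ∈ Ξ.image idx, (1 / 4 : ℝ) ^ n ≤ 2 := by
          have h2 := (summable_geometric_of_lt_one (r := (1 / 4 : ℝ)) (by norm_num)
            (by norm_num)).sum_le_tsum (Ξ.image idx) fun _ _ => by positivity
          rw [tsum_geometric_of_lt_one (by norm_num) (by norm_num)] at h2
          linarith
        have h3 : X ≤ Q / lam ^ 2 := by
          rw [hX]; gcongr; nlinarith [P.e_le_half]
        gcongr
    _ = _ := by ring

end Recursion

lemma pow_mul_dual_le {d : ℕ} (hd : 2 ≤ d) {Q lam κ A a : ℝ} (hQ : 0 < Q) (hκ : 1 ≤ κ)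
    (hlam : κ ≤ lam) (hA : 0 ≤ A) (ha : 0 ≤ a) :
    lam ^ (d + 2) * ((Q / lam ^ 2) ^ d * (A / lam ^ 2 + a)) ≤ Q ^ d * (A + a / κ ^ (d - 2)) := by
  obtain ⟨k, rfl⟩ := Nat.exists_eq_add_of_le' hd
  have hl : 0 < lam := by linarith
  rw [Nat.add_sub_cancel]
  have e1 : lam ^ (k + 2 + 2) * ((Q / lam ^ 2) ^ (k + 2) * (A / lam ^ 2 + a)) =
      Q ^ (k + 2) * (A / lam ^ (k + 2) + a / lam ^ k) := by
    rw [div_pow, ← pow_mul]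
    field_simp
    ring
  rw [e1]
  gcongr
  exact div_le_self hA (one_le_pow₀ (by linarith))

lemma pow_mul_cells_le {d : ℕ} {Q lam κ δ D h₀ B N : ℝ} (hh : 0 < h₀) (hQ : h₀ ≤ Q)
    (hκ : 1 ≤ κ) (hδ : 0 < δ) (hδD : δ ≤ D) (hl0 : 0 < lam) (hB : 1 ≤ B)
    (hlam : lam ^ 2 = max (δ * Q) (κ ^ 2)) (hN : N ≤ (2 * (B * Q / lam + 1) + 1) ^ d) :
    lam ^ (d + 2) * N ≤
      (2 * B + 3 * (D / h₀ + 1 / h₀ + 1)) ^ d * (δ * Q ^ (d + 1) + κ ^ (2 * d + 2) * Q ^ d) := by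
  have hQ0 : 0 < Q := hh.trans_le hQ
  have hD : 0 < D := hδ.trans_le hδD
  have hQh : 1 ≤ Q / h₀ := (one_le_div hh).2 hQ
  have h1 : lam ^ (d + 2) * N ≤ lam ^ 2 * (2 * B * Q + 3 * lam) ^ d := by
    calc lam ^ (d + 2) * N ≤ lam ^ (d + 2) * (2 * (B * Q / lam + 1) + 1) ^ d := by gcongr
      _ = lam ^ 2 * (lam * (2 * (B * Q / lam + 1) + 1)) ^ d := by rw [mul_pow]; ring
      _ = _ := by
        congr 2; field_simp; ring
  refine h1.trans ?_
  set G := 2 * B + 3 * (D / h₀ + 1 / h₀ + 1) with hG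
  have hG0 : 0 < G := by positivity
  rcases le_total (κ ^ 2) (δ * Q) with h | h
  · rw [max_eq_left h] at hlam
    have h2 : lam ≤ (D / h₀ + 1) * Q := by
      refine (pow_le_pow_iff_left₀ hl0.le (by positivity) two_ne_zero).1 ?_
      rw [hlam]
      have h3 : δ * Q ≤ D / h₀ * Q ^ 2 := by
        calc δ * Q ≤ D * Q * 1 := by rw [mul_one]; gcongr
          _ ≤ D * Q * (Q / h₀) := by gcongr
          _ = _ := by ring
      have h4 : 0 < D / h₀ * Q ^ 2 := by positivity
      have h5 : 0 ≤ (D / h₀ * Q) ^ 2 := by positivity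
      nlinarith [sq_nonneg Q]
    have h3 : 2 * B * Q + 3 * lam ≤ G * Q := by
      have : 0 ≤ 1 / h₀ * Q := by positivity
      rw [hG]; nlinarith
    calc lam ^ 2 * (2 * B * Q + 3 * lam) ^ d ≤ (δ * Q) * (G * Q) ^ d := by rw [hlam]; gcongr
      _ = G ^ d * (δ * Q ^ (d + 1) + 0) := by rw [mul_pow]; ring
      _ ≤ _ := by gcongr; positivity
  · rw [max_eq_right h] at hlam
    obtain rfl : lam = κ := (pow_left_inj₀ hl0.le (by linarith) two_ne_zero).1 hlam
    have h3 : 2 * B * Q + 3 * lam ≤ G * lam * Q := by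
      have h4 : 3 * lam ≤ 3 * lam * (Q / h₀) := le_mul_of_one_le_right (by positivity) hQh
      have h5 : 2 * B * Q * 1 ≤ 2 * B * Q * lam := by gcongr
      have h6 : 0 ≤ (3 * (D / h₀ + 1)) * lam * Q := by positivity
      have h7 : G * lam * Q = 2 * B * Q * lam + 3 * lam * (Q / h₀) + (3 * (D / h₀ + 1)) * lam * Q := by
        rw [hG]; ring
      linarith
    calc lam ^ 2 * (2 * B * Q + 3 * lam) ^ d ≤ lam ^ 2 * (G * lam * Q) ^ d := by gcongr
      _ = G ^ d * (0 + lam ^ (d + 2) * Q ^ d) := by rw [mul_pow, mul_pow]; ring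
      _ ≤ _ := by
        have : lam ^ (d + 2) ≤ lam ^ (2 * d + 2) := pow_le_pow_right₀ hκ (by omega)
        gcongr
        positivity

section Recursion

variable {ι : Type*} [Fintype ι] {d : ℕ} {M : Type*}

/-- One step of the recursion: a bound for the dual problem up to `Q₁` gives a bound for the
original problem up to `κ ^ 2 * Q₁`. -/
lemma exists_bound_step (hd : 2 ≤ d) {V : (ι → ℝ) ≃ₗ[ℝ] Amb d} (hV : Isometric V)
    {c : Contact d M} {h₀ e r g D : ℝ} (P : Params c h₀ e r g D) :
    ∃ C > (0 : ℝ), ∀ κ A a Q₁ : ℝ, 1 ≤ κ → 0 ≤ A → 0 ≤ a →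
      Bound (dual V) c.swap h₀ r g D Q₁ A a →
      Bound V c h₀ r g D (κ ^ 2 * Q₁) C (C * (κ ^ (2 * d + 2) + A + a / κ ^ (d - 2))) := by
  classical
  obtain ⟨K, hK, hcell⟩ := exists_card_cell_le hd hV P
  obtain ⟨C, hC, hsum⟩ := exists_sum_card_le hd V P
  have hB := c.one_le_B
  have hh := P.h₀_pos
  have hL := c.one_le_L
  have hD := P.one_le_D
  set G := (2 * c.B + 3 * (D / h₀ + 1 / h₀ + 1)) ^ d with hG
  have hG0 : 0 < G := by positivity
  refine ⟨K * G + 2 * K * C, by positivity, ?_⟩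
  intro κ A a Q₁ hκ hA ha hbound Q δ F hQ hQ₁ hδ hδD hF
  rcases F.eq_empty_or_nonempty with rfl | ⟨z₀, hz₀⟩
  · have : 0 < Q := hh.trans_le hQ
    simp only [Finset.card_empty, Nat.cast_zero]
    positivity
  obtain ⟨-, -, m₀, -⟩ := hF z₀ hz₀
  have hQ0 : 0 < Q := hh.trans_le hQ
  set lam := √(max (δ * Q) (κ ^ 2)) with hlam
  have hlam2 : lam ^ 2 = max (δ * Q) (κ ^ 2) := Real.sq_sqrt (le_max_of_le_right (sq_nonneg κ))
  have hκlam : κ ≤ lam := Real.le_sqrt_of_sq_le (le_max_right _ _)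
  have hlam1 : 1 ≤ lam := hκ.trans hκlam
  have hl0 : 0 < lam := by linarith
  have hm : ∀ z, ∃ m, z ∈ F → c.rad m ≤ r + g / Q ∧ (lat V z).2.1 = (lat V z).1 • c.y m ∧
      |(lat V z).2.2 - (lat V z).1 * c.u m| ≤ δ := by
    intro z
    by_cases hz : z ∈ F
    · obtain ⟨-, -, m, h⟩ := hF z hz
      exact ⟨m, fun _ => h⟩
    · exact ⟨m₀, fun h => absurd h hz⟩
  choose m hm using hm
  set cell : (ι → ℤ) → Fin d → ℤ := fun z j => ⌊c.y (m z) j / (lam / Q)⌋ with hcelldef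
  have hρ : 0 < lam / Q := by positivity
  have hbox : ∀ z j, lam / Q * cell z j ≤ c.y (m z) j ∧
      c.y (m z) j ≤ lam / Q * (cell z j + 1) := by
    intro z j
    have h1 := Int.floor_le (c.y (m z) j / (lam / Q))
    have h2 := (Int.lt_floor_add_one (c.y (m z) j / (lam / Q))).le
    rw [le_div_iff₀ hρ] at h1
    rw [div_le_iff₀ hρ] at h2
    exact ⟨by rw [mul_comm]; exact h1, by rw [mul_comm]; exact h2⟩
  set T := F.image cell with hT
  have hrep : ∀ k, ∃ z, k ∈ T → z ∈ F ∧ cell z = k := by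
    intro k
    by_cases hk : k ∈ T
    · obtain ⟨z, hz⟩ := Finset.mem_image.1 hk
      exact ⟨z, fun _ => hz⟩
    · exact ⟨z₀, fun h => absurd h hk⟩
  choose rep hrep using hrep
  have hfib : ∀ k, ∃ W : Finset (ι → ℤ), k ∈ T →
      (∀ w ∈ W, DualNear V c h₀ e Q lam (m (rep k)) w) ∧
      ((F.filter fun z => cell z = k).card : ℝ) ≤ K * lam ^ (d + 2) * (1 + 2 * W.card) := by
    intro k
    by_cases hk : k ∈ T
    swap
    · exact ⟨∅, fun h => absurd h hk⟩
    obtain ⟨W, hW⟩ := hcell (m (rep k)) Q lam (F.filter fun z => cell z = k) hQ hlam1 (by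
      intro z hz
      obtain ⟨hzF, hzk⟩ := Finset.mem_filter.1 hz
      obtain ⟨-, h2, h3⟩ := hm z hzF
      obtain ⟨q1, q2, -⟩ := hF z hzF
      generalize lat V z = x at *
      have hx0 : 0 < x.1 := hh.trans_le q1
      have hy : ‖c.y (m z) - c.y (m (rep k))‖ ≤ lam / Q := by
        rw [pi_norm_le_iff_of_nonneg hρ.le]
        intro j
        have h4 := hbox z j
        have h5 := hbox (rep k) j
        rw [show cell (rep k) j = cell z j by rw [(hrep k hk).2, hzk]] at h5
        rw [Pi.sub_apply, Real.norm_eq_abs, abs_le]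
        constructor <;> nlinarith [h4.1, h4.2, h5.1, h5.2]
      have e1 : x.2.1 - x.1 • c.y (m (rep k)) = x.1 • (c.y (m z) - c.y (m (rep k))) := by
        rw [h2, smul_sub]
      refine ⟨by rw [abs_of_pos hx0]; exact q2, ?_, ?_⟩
      · rw [e1, norm_smul, Real.norm_of_nonneg hx0.le]
        calc x.1 * ‖c.y (m z) - c.y (m (rep k))‖ ≤ Q * (lam / Q) := by gcongr
          _ = lam := by field_simp
      · rw [e1, smul_dotProduct, smul_eq_mul, dotProduct_comm]
        have h4 := c.taylor_u (m (rep k)) (m z)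
        have e2 : x.2.2 - x.1 * c.u (m (rep k)) -
            x.1 * (c.p (m (rep k)) ⬝ᵥ (c.y (m z) - c.y (m (rep k)))) =
            (x.2.2 - x.1 * c.u (m z)) + x.1 * (c.u (m z) - c.u (m (rep k)) -
              c.p (m (rep k)) ⬝ᵥ (c.y (m z) - c.y (m (rep k)))) := by ring
        rw [e2]
        refine (abs_add_le _ _).trans ?_
        rw [abs_mul, abs_of_pos hx0]
        have h5 : x.1 * |c.u (m z) - c.u (m (rep k)) -
              c.p (m (rep k)) ⬝ᵥ (c.y (m z) - c.y (m (rep k)))| ≤ Q * (c.L * (lam / Q) ^ 2) := by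
          gcongr
          exact h4.trans (by gcongr)
        have h6 : δ ≤ lam ^ 2 / Q := by
          rw [le_div_iff₀ hQ0, hlam2]; exact le_max_left _ _
        have h7 : Q * (c.L * (lam / Q) ^ 2) = c.L * lam ^ 2 / Q := by field_simp
        have h8 : (1 + c.L) * lam ^ 2 / Q = lam ^ 2 / Q + c.L * lam ^ 2 / Q := by ring
        linarith)
    exact ⟨W, fun _ => hW⟩
  choose W hW using hfib
  have hs := hsum A a Q₁ Q lam T (fun k => m (rep k)) W hA ha hbound hQ hlam1 (by
      rw [div_le_iff₀ (by positivity)]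
      have h1 : κ ^ 2 ≤ lam ^ 2 := by gcongr
      have h2 : 0 < Q₁ := by
        by_contra! h
        nlinarith [sq_nonneg κ]
      have h3 := P.e_le_half
      have h4 : e * Q ≤ 1 * Q := by gcongr; linarith
      nlinarith)
    (fun k hk j => by
      have := hbox (rep k) j
      rwa [(hrep k hk).2] at this)
    (fun k hk => (hm _ (hrep k hk).1).1) (fun k hk => (hW k hk).1)
  have hTcard : (T.card : ℝ) ≤ (2 * (c.B * Q / lam + 1) + 1) ^ d := by
    have h1 := card_le_of_box T (fun _ : Fin d => (0 : ℝ)) (fun _ => c.B * Q / lam + 1)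
      (fun _ => by positivity) (by
        intro k hk j
        have h2 := hbox (rep k) j
        rw [(hrep k hk).2] at h2
        have h3 := (norm_le_pi_norm (c.y (m (rep k))) j).trans (c.norm_y_le _)
        rw [Real.norm_eq_abs, abs_le] at h3
        have h4 : c.B = lam / Q * (c.B * Q / lam) := by field_simp
        rw [sub_zero, abs_le]
        constructor
        · by_contra! h5
          nlinarith [mul_lt_mul_of_pos_left h5 hρ]
        · by_contra! h5
          nlinarith [mul_lt_mul_of_pos_left h5 hρ])
    simpa using h1
  have hN := pow_mul_cells_le hh hQ hκ hδ hδD hl0 hB hlam2 hTcard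
  have hU := pow_mul_dual_le hd hQ0 hκ hκlam hA ha
  have hcard : (F.card : ℝ) ≤
      K * (lam ^ (d + 2) * T.card) + 2 * K * (lam ^ (d + 2) * ∑ k ∈ T, ((W k).card : ℝ)) := by
    have h1 : F.card = ∑ k ∈ T, (F.filter fun z => cell z = k).card :=
      Finset.card_eq_sum_card_image cell F
    rw [h1, Nat.cast_sum]
    calc ∑ k ∈ T, ((F.filter fun z => cell z = k).card : ℝ)
        ≤ ∑ k ∈ T, K * lam ^ (d + 2) * (1 + 2 * ((W k).card : ℝ)) :=
          Finset.sum_le_sum fun k hk => (hW k hk).2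
      _ = _ := by
        rw [← Finset.mul_sum, Finset.sum_add_distrib, ← Finset.mul_sum, Finset.sum_const,
          nsmul_eq_mul]
        ring
  have h1 : lam ^ (d + 2) * ∑ k ∈ T, ((W k).card : ℝ) ≤ C * (Q ^ d * (A + a / κ ^ (d - 2))) := by
    calc lam ^ (d + 2) * ∑ k ∈ T, ((W k).card : ℝ)
        ≤ lam ^ (d + 2) * (C * (Q / lam ^ 2) ^ d * (A / lam ^ 2 + a)) := by gcongr
      _ = C * (lam ^ (d + 2) * ((Q / lam ^ 2) ^ d * (A / lam ^ 2 + a))) := by ring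
      _ ≤ _ := by gcongr
  calc (F.card : ℝ) ≤ _ := hcard
    _ ≤ K * (G * (δ * Q ^ (d + 1) + κ ^ (2 * d + 2) * Q ^ d)) +
        2 * K * (C * (Q ^ d * (A + a / κ ^ (d - 2)))) := by gcongr
    _ ≤ K * (G * (δ * Q ^ (d + 1) + κ ^ (2 * d + 2) * Q ^ d)) +
        2 * K * (C * (Q ^ d * (A + a / κ ^ (d - 2)))) +
        (K * G * (Q ^ d * (A + a / κ ^ (d - 2))) +
          2 * K * C * (δ * Q ^ (d + 1) + κ ^ (2 * d + 2) * Q ^ d)) :=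
        le_add_of_nonneg_right (by positivity)
    _ = _ := by ring

end Recursion

section Iteration

variable {ι : Type*} {d : ℕ} {M : Type*}

lemma Bound.mono {V : (ι → ℝ) ≃ₗ[ℝ] Amb d} {c : Contact d M} {h₀ r g D Q₁ Q₂ A A' a a' : ℝ}
    (h : Bound V c h₀ r g D Q₁ A a) (hh : 0 ≤ h₀) (hQ : Q₂ ≤ Q₁) (hA : A ≤ A') (ha : a ≤ a') :
    Bound V c h₀ r g D Q₂ A' a' := by
  intro Q δ F h1 h2 h3 h4 h5
  have : 0 ≤ Q := hh.trans h1
  refine (h Q δ F h1 (h2.trans hQ) h3 h4 h5).trans ?_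
  gcongr

/-- There are no lattice points with denominator below `h₀`. -/
lemma bound_base {V : (ι → ℝ) ≃ₗ[ℝ] Amb d} {c : Contact d M} {h₀ r g D : ℝ} (hh : 0 < h₀)
    (A a : ℝ) : Bound V c h₀ r g D (h₀ / 2) A a := by
  intro Q δ F h1 h2
  linarith

variable [Fintype ι]

/-- The recursive step for a hypersurface and its dual simultaneously. -/
lemma exists_bound_pair_step (hd : 2 ≤ d) {V : (ι → ℝ) ≃ₗ[ℝ] Amb d} (hV : Isometric V)
    {c : Contact d M} {h₀ e r g D : ℝ} (P : Params c h₀ e r g D) :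
    ∃ A > (0 : ℝ), ∀ κ a Q₁ : ℝ, 1 ≤ κ → 0 ≤ a →
      Bound V c h₀ r g D Q₁ A a ∧ Bound (dual V) c.swap h₀ r g D Q₁ A a →
      Bound V c h₀ r g D (κ ^ 2 * Q₁) A (A * (κ ^ (2 * d + 2) + A + a / κ ^ (d - 2))) ∧
      Bound (dual V) c.swap h₀ r g D (κ ^ 2 * Q₁) A
        (A * (κ ^ (2 * d + 2) + A + a / κ ^ (d - 2))) := by
  obtain ⟨C₁, hC₁, h₁⟩ := exists_bound_step hd hV P
  obtain ⟨C₂, hC₂, h₂⟩ := exists_bound_step hd hV.dual P.swap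
  have hh := P.h₀_pos.le
  refine ⟨C₁ + C₂, by positivity, ?_⟩
  rintro κ a Q₁ hκ ha ⟨hb, hb'⟩
  have hpos : 0 ≤ κ ^ (2 * d + 2) + (C₁ + C₂) + a / κ ^ (d - 2) := by positivity
  refine ⟨(h₁ κ (C₁ + C₂) a Q₁ hκ (by positivity) ha hb').mono hh le_rfl (by linarith) ?_,
    (h₂ κ (C₁ + C₂) a Q₁ hκ (by positivity) ha ?_).mono hh le_rfl (by linarith) ?_⟩
  · gcongr; linarith
  · rw [dual_dual]; exact hb
  · gcongr; linarith

lemma exists_bound_of_three_le (hd : 3 ≤ d) {V : (ι → ℝ) ≃ₗ[ℝ] Amb d} (hV : Isometric V)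
    {c : Contact d M} {h₀ e r g D : ℝ} (P : Params c h₀ e r g D) :
    ∃ A > (0 : ℝ), ∀ Q, Bound V c h₀ r g D Q A A := by
  obtain ⟨A, hA, hstep⟩ := exists_bound_pair_step (by omega) hV P
  have hh := P.h₀_pos
  set κ := 2 + 2 * A with hκ
  have hκ1 : 1 ≤ κ := by linarith
  set a := 2 * (A * (κ ^ (2 * d + 2) + A)) with ha
  have ha0 : 0 < a := by positivity
  have hiter : ∀ m : ℕ, Bound V c h₀ r g D ((κ ^ 2) ^ m * (h₀ / 2)) A a ∧
      Bound (dual V) c.swap h₀ r g D ((κ ^ 2) ^ m * (h₀ / 2)) A a := by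
    intro m
    induction m with
    | zero => rw [pow_zero, one_mul]; exact ⟨bound_base hh _ _, bound_base hh _ _⟩
    | succ m ih =>
      have h1 := hstep κ a _ hκ1 ha0.le ih
      rw [← mul_assoc, ← pow_succ'] at h1
      have h2 : A * (κ ^ (2 * d + 2) + A + a / κ ^ (d - 2)) ≤ a := by
        have h3 : κ ≤ κ ^ (d - 2) := le_self_pow₀ hκ1 (by omega)
        have h4 : a / κ ^ (d - 2) ≤ a / κ := by gcongr
        have h5 : A * (a / κ) ≤ a / 2 := by
          rw [mul_div_assoc', div_le_div_iff₀ (by positivity) two_pos]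
          nlinarith
        nlinarith
      exact ⟨h1.1.mono hh.le le_rfl le_rfl h2, h1.2.mono hh.le le_rfl le_rfl h2⟩
  refine ⟨A + a, by positivity, fun Q => ?_⟩
  obtain ⟨m, hm⟩ := pow_unbounded_of_one_lt (Q / (h₀ / 2)) (show 1 < κ ^ 2 by nlinarith)
  rw [div_lt_iff₀ (by positivity)] at hm
  exact (hiter m).1.mono hh.le hm.le (by linarith) (by linarith)

lemma exists_bound_of_two {V : (ι → ℝ) ≃ₗ[ℝ] Amb 2} (hV : Isometric V)
    {c : Contact 2 M} {h₀ e r g D : ℝ} (P : Params c h₀ e r g D) :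
    ∃ A > (0 : ℝ), ∃ b > (0 : ℝ), ∀ Q, 2 ≤ Q →
      Bound V c h₀ r g D Q A (A * Real.exp (b * √(Real.log Q))) := by
  obtain ⟨A, hA, hstep⟩ := exists_bound_pair_step le_rfl hV P
  have hh := P.h₀_pos
  set X := 1 + 2 * A + A ^ 2 with hX
  have hX1 : 1 ≤ X := by rw [hX]; nlinarith
  have hiter : ∀ (κ : ℝ), 1 ≤ κ → ∀ m : ℕ,
      Bound V c h₀ r g D ((κ ^ 2) ^ m * (h₀ / 2)) A (κ ^ 6 * X ^ m) ∧
      Bound (dual V) c.swap h₀ r g D ((κ ^ 2) ^ m * (h₀ / 2)) A (κ ^ 6 * X ^ m) := by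
    intro κ hκ m
    induction m with
    | zero => rw [pow_zero, one_mul]; exact ⟨bound_base hh _ _, bound_base hh _ _⟩
    | succ m ih =>
      have h1 := hstep κ (κ ^ 6 * X ^ m) _ hκ (by positivity) ih
      rw [← mul_assoc, ← pow_succ'] at h1
      have h2 : A * (κ ^ (2 * 2 + 2) + A + κ ^ 6 * X ^ m / κ ^ (2 - 2)) ≤
          κ ^ 6 * X ^ (m + 1) := by
        have h3 : (1 : ℝ) ≤ κ ^ 6 := one_le_pow₀ hκ
        have h4 : (1 : ℝ) ≤ X ^ m := one_le_pow₀ hX1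
        have h5 : κ ^ 6 ≤ κ ^ 6 * X ^ m := le_mul_of_one_le_right (by positivity) h4
        rw [show 2 * 2 + 2 = 6 from rfl, Nat.sub_self, pow_zero, div_one, pow_succ X, ← mul_assoc]
        have h6 := h3.trans h5
        set Y := κ ^ 6 * X ^ m
        rw [hX]
        nlinarith [mul_le_mul_of_nonneg_left h5 hA.le, mul_le_mul_of_nonneg_left h6 (sq_nonneg A)]
      exact ⟨h1.1.mono hh.le le_rfl le_rfl h2, h1.2.mono hh.le le_rfl le_rfl h2⟩
  set E := |Real.log (2 / h₀)| with hE
  have hE0 : 0 ≤ E := abs_nonneg _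
  have hlX : 0 ≤ Real.log X := Real.log_nonneg hX1
  refine ⟨A + Real.exp ((E + 1) * Real.log X), by positivity, 6 + Real.log X, by positivity,
    fun Q hQ => ?_⟩
  have hQ0 : 0 < Q := by linarith
  set s := √(Real.log Q) with hs
  have hlog : 1 / 4 ≤ Real.log Q := by
    have := Real.log_le_log two_pos hQ
    linarith [Real.log_two_gt_d9]
  have hs2 : s ^ 2 = Real.log Q := Real.sq_sqrt (by linarith)
  have hs1 : 1 / 2 ≤ s := Real.le_sqrt_of_sq_le (by linarith)
  set m := ⌈s + E⌉₊ with hm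
  have hm1 : s + E ≤ m := Nat.le_ceil _
  have hm2 : (m : ℝ) < s + E + 1 := Nat.ceil_lt_add_one (by positivity)
  have hκ : 1 ≤ Real.exp s := Real.one_le_exp (by linarith)
  refine (hiter (Real.exp s) hκ m).1.mono hh.le ?_ (by linarith [Real.exp_pos ((E + 1) * Real.log X)]) ?_
  · have h1 : Real.log (2 / h₀) ≤ E := le_abs_self _
    have h2 : Real.log Q + Real.log (2 / h₀) ≤ m * (2 * s) := by nlinarith
    have h3 := Real.exp_le_exp.2 h2
    rw [Real.exp_add, Real.exp_log hQ0, Real.exp_log (by positivity), Real.exp_nat_mul,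
      two_mul, Real.exp_add, ← pow_two] at h3
    calc Q = Q * (2 / h₀) * (h₀ / 2) := by field_simp
      _ ≤ _ := by gcongr
  · have h1 : Real.exp s ^ 6 * X ^ m ≤
        Real.exp ((E + 1) * Real.log X) * Real.exp ((6 + Real.log X) * s) := by
      have h2 : X ^ m = Real.exp (m * Real.log X) := by
        rw [Real.exp_nat_mul, Real.exp_log (by linarith)]
      rw [h2, ← Real.exp_nat_mul, ← Real.exp_add, ← Real.exp_add, Real.exp_le_exp]
      push_cast
      nlinarith
    refine h1.trans ?_
    gcongr
    linarith

/-- The counting bound for one contact family. -/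
lemma exists_bound (hd : 2 ≤ d) {V : (ι → ℝ) ≃ₗ[ℝ] Amb d} (hV : Isometric V)
    {c : Contact d M} {h₀ e r g D : ℝ} (P : Params c h₀ e r g D) :
    ∃ A > (0 : ℝ), ∃ b > (0 : ℝ), ∀ Q, 2 ≤ Q →
      Bound V c h₀ r g D Q A (A * if d = 2 then Real.exp (b * √(Real.log Q)) else 1) := by
  split_ifs with h
  · subst h
    exact exists_bound_of_two hV P
  · obtain ⟨A, hA, hb⟩ := exists_bound_of_three_le (by omega) hV P
    exact ⟨A, hA, 1, one_pos, fun Q _ => by rw [mul_one]; exact hb Q⟩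

end Iteration

section Chart

open scoped NNReal Topology

/-- Quantitative inverse function theorem: near a point with invertible derivative, a map is
bi-Lipschitz and open at a linear rate. -/
lemma exists_biLipschitz {E : Type*} [NormedAddCommGroup E] [NormedSpace ℝ E] [CompleteSpace E]
    [Nontrivial E] {G : E → E} {G' : E ≃L[ℝ] E} {y₀ : E}
    (hG : HasStrictFDerivAt G (G' : E →L[ℝ] E) y₀) :
    ∃ K : ℝ, 1 ≤ K ∧ ∃ s ∈ 𝓝 y₀, (∀ x ∈ s, ∀ x' ∈ s, ‖G x - G x'‖ ≤ K * ‖x - x'‖) ∧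
      (∀ x ∈ s, ∀ x' ∈ s, ‖x - x'‖ ≤ K * ‖G x - G x'‖) ∧
      ∀ x t, 0 ≤ t → Metric.closedBall x t ⊆ s →
        ∀ q, ‖q - G x‖ ≤ t / K → ∃ x' ∈ Metric.closedBall x t, G x' = q := by
  have hpos : 0 < ‖(G'.symm : E →L[ℝ] E)‖₊ := G'.nnnorm_symm_pos
  set N := ‖(G'.symm : E →L[ℝ] E)‖₊ with hN
  obtain ⟨s, hs, happ⟩ := hG.approximates_deriv_on_nhds (c := N⁻¹ / 2) (Or.inr (by positivity))
  have hsub : N⁻¹ - N⁻¹ / 2 = N⁻¹ / 2 := by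
    rw [← NNReal.coe_inj, NNReal.coe_sub (by exact NNReal.half_le_self _)]; push_cast; ring
  have hanti := happ.antilipschitz (Or.inr (NNReal.half_lt_self (by positivity)))
  have hlip := happ.lipschitz
  rw [← hN, hsub] at hanti
  set K₁ : ℝ≥0 := ‖(G' : E →L[ℝ] E)‖₊ + N⁻¹ / 2
  set K₂ : ℝ≥0 := (N⁻¹ / 2)⁻¹ with hK₂
  have hK₂0 : (0 : ℝ) < K₂ := by rw [hK₂]; positivity
  refine ⟨1 + K₁ + K₂, by linarith [K₁.2, K₂.2, show (0 : ℝ) ≤ K₁ from K₁.2], s, hs, ?_, ?_, ?_⟩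
  · intro x hx x' hx'
    have h := hlip.dist_le_mul ⟨x, hx⟩ ⟨x', hx'⟩
    rw [dist_eq_norm, Subtype.dist_eq, dist_eq_norm] at h
    exact h.trans (mul_le_mul_of_nonneg_right (by linarith) (norm_nonneg _))
  · intro x hx x' hx'
    have h := hanti.le_mul_dist ⟨x, hx⟩ ⟨x', hx'⟩
    rw [Subtype.dist_eq, dist_eq_norm, dist_eq_norm] at h
    exact h.trans (mul_le_mul_of_nonneg_right (by linarith [show (0 : ℝ) ≤ K₁ from K₁.2])
      (norm_nonneg _))
  · intro x t ht hts q hq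
    have h := happ.surjOn_closedBall_of_nonlinearRightInverse G'.toNonlinearRightInverse ht hts
    have h1 : (((G'.toNonlinearRightInverse.nnnorm : ℝ))⁻¹ - (N⁻¹ / 2 : ℝ≥0)) = (K₂ : ℝ)⁻¹ := by
      change ((N : ℝ))⁻¹ - (N⁻¹ / 2 : ℝ≥0) = (K₂ : ℝ)⁻¹
      rw [hK₂]; push_cast; rw [inv_inv]; ring
    rw [h1] at h
    have h2 : q ∈ Metric.closedBall (G x) ((K₂ : ℝ)⁻¹ * t) := by
      rw [Metric.mem_closedBall, dist_eq_norm]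
      refine hq.trans ?_
      rw [div_eq_inv_mul]
      gcongr
      linarith [show (0 : ℝ) ≤ K₁ from K₁.2]
    obtain ⟨x', hx', rfl⟩ := h h2
    exact ⟨x', hx', rfl⟩

variable {d : ℕ}

/-- The gradient of `f` in coordinates. -/
noncomputable def grad (f : (Fin d → ℝ) → ℝ) (y : Fin d → ℝ) : Fin d → ℝ :=
  fun j => fderiv ℝ f y (Pi.single j 1)

lemma continuousLinearMap_apply_eq (φ : (Fin d → ℝ) →L[ℝ] ℝ) (w : Fin d → ℝ) :
    φ w = (fun j => φ (Pi.single j 1)) ⬝ᵥ w := by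
  have h := LinearMap.pi_apply_eq_sum_univ (φ : (Fin d → ℝ) →ₗ[ℝ] ℝ) w
  simp only [ContinuousLinearMap.coe_coe, smul_eq_mul] at h
  rw [h, dotProduct]
  refine Finset.sum_congr rfl fun i _ => ?_
  rw [mul_comm]
  congr 2
  ext j
  simp [Pi.single_apply, eq_comm]

lemma fderiv_apply_eq_grad (f : (Fin d → ℝ) → ℝ) (y w : Fin d → ℝ) :
    fderiv ℝ f y w = grad f y ⬝ᵥ w :=
  continuousLinearMap_apply_eq _ _

lemma norm_fderiv_sub_le (f : (Fin d → ℝ) → ℝ) (y y' : Fin d → ℝ) :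
    ‖fderiv ℝ f y - fderiv ℝ f y'‖ ≤ d * ‖grad f y - grad f y'‖ := by
  refine ContinuousLinearMap.opNorm_le_bound _ (by positivity) fun w => ?_
  rw [_root_.sub_apply, fderiv_apply_eq_grad, fderiv_apply_eq_grad, ← sub_dotProduct,
    Real.norm_eq_abs, mul_assoc]
  exact abs_dotProduct_le _ _

lemma taylor_of_grad_lipschitz {f : (Fin d → ℝ) → ℝ} {s : Set (Fin d → ℝ)} (hs : Convex ℝ s)
    (hf : ∀ y ∈ s, DifferentiableAt ℝ f y) {K : ℝ} (hK : 0 ≤ K)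
    (hlip : ∀ x ∈ s, ∀ x' ∈ s, ‖grad f x - grad f x'‖ ≤ K * ‖x - x'‖) {y y' : Fin d → ℝ}
    (hy : y ∈ s) (hy' : y' ∈ s) :
    |f y' - f y - grad f y ⬝ᵥ (y' - y)| ≤ d * K * ‖y' - y‖ ^ 2 := by
  have hsub : segment ℝ y y' ⊆ s := hs.segment_subset hy hy'
  have h := Convex.norm_image_sub_le_of_norm_hasFDerivWithin_le' (f := f) (s := segment ℝ y y')
    (f' := fderiv ℝ f) (φ := fderiv ℝ f y) (C := d * (K * ‖y' - y‖))
    (fun x hx => (hf x (hsub hx)).hasFDerivAt.hasFDerivWithinAt)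
    (fun x hx => by
      refine (norm_fderiv_sub_le f x y).trans ?_
      gcongr
      refine (hlip x (hsub hx) y hy).trans ?_
      gcongr
      exact norm_sub_le_of_mem_segment hx) (convex_segment y y')
    (left_mem_segment ℝ y y') (right_mem_segment ℝ y y')
  rw [fderiv_apply_eq_grad, Real.norm_eq_abs] at h
  refine h.trans (le_of_eq (by ring))

lemma exists_hasStrictFDerivAt_grad {f : (Fin d → ℝ) → ℝ} {U : Set (Fin d → ℝ)} (hU : IsOpen U)
    (hf : ContDiffOn ℝ 2 f U) {y₀ : Fin d → ℝ} (hy₀ : y₀ ∈ U) (hdet : (hess f y₀).det ≠ 0) :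
    ∃ G' : (Fin d → ℝ) ≃L[ℝ] (Fin d → ℝ),
      HasStrictFDerivAt (grad f) (G' : (Fin d → ℝ) →L[ℝ] (Fin d → ℝ)) y₀ := by
  have h1 : ContDiffAt ℝ 1 (fderiv ℝ f) y₀ :=
    (hf.fderiv_of_isOpen hU (m := 1) (by norm_num)).contDiffAt (hU.mem_nhds hy₀)
  have h2 : ContDiffAt ℝ 1 (grad f) y₀ := by
    rw [contDiffAt_pi]
    exact fun j => h1.clm_apply contDiffAt_const
  have h3 := h2.hasStrictFDerivAt one_ne_zero
  have h4 : ∀ w, fderiv ℝ (grad f) y₀ w = (hess f y₀).transpose.mulVec w := by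
    intro w
    ext j
    have h5 := (hasFDerivAt_pi'.1 h3.hasFDerivAt j).fderiv
    have h6 : fderiv ℝ (grad f) y₀ w j =
        fderiv ℝ (fun y => fderiv ℝ f y (Pi.single j 1)) y₀ w := by
      change _ = fderiv ℝ (fun y => grad f y j) y₀ w
      rw [h5]; rfl
    rw [h6, continuousLinearMap_apply_eq]
    rfl
  have hinj : Function.Injective (fderiv ℝ (grad f) y₀ : (Fin d → ℝ) →ₗ[ℝ] (Fin d → ℝ)) := by
    have h5 : Function.Injective (hess f y₀).transpose.mulVec := by
      rw [Matrix.mulVec_injective_iff_isUnit, Matrix.isUnit_iff_isUnit_det, Matrix.det_transpose]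
      exact isUnit_iff_ne_zero.2 hdet
    intro x y hxy
    apply h5
    rw [← h4, ← h4]
    exact hxy
  refine ⟨(LinearEquiv.ofInjectiveEndo _ hinj).toContinuousLinearEquiv, ?_⟩
  have h5 : (((LinearEquiv.ofInjectiveEndo _ hinj).toContinuousLinearEquiv :
      (Fin d → ℝ) ≃L[ℝ] (Fin d → ℝ)) : (Fin d → ℝ) →L[ℝ] (Fin d → ℝ)) =
      fderiv ℝ (grad f) y₀ := by
    ext1 w; rfl
  rw [h5]
  exact h3

/-- The graph of a function with nondegenerate Hessian is locally a contact family. -/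
lemma exists_contact (hd : 2 ≤ d) {f : (Fin d → ℝ) → ℝ} {U : Set (Fin d → ℝ)} (hU : IsOpen U)
    (hf : ContDiffOn ℝ 2 f U) {y₀ : Fin d → ℝ} (hy₀ : y₀ ∈ U) (hdet : (hess f y₀).det ≠ 0) :
    ∃ ρ > (0 : ℝ), ∃ c : Contact d (Metric.ball y₀ ρ), (∀ m, c.y m = m) ∧ (∀ m, c.u m = f m) ∧
      (∀ m, c.rad m = ‖(m : Fin d → ℝ) - y₀‖) ∧ 0 < c.R ∧ c.R ≤ ρ := by
  obtain ⟨G', hG'⟩ := exists_hasStrictFDerivAt_grad hU hf hy₀ hdet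
  have : Nonempty (Fin d) := ⟨⟨0, by omega⟩⟩
  obtain ⟨K, hK, s, hs, hlip, hanti, hsurj⟩ := exists_biLipschitz hG'
  obtain ⟨ρ, hρ, hball⟩ := Metric.mem_nhds_iff.1 (Filter.inter_mem hs (hU.mem_nhds hy₀))
  have hK0 : 0 < K := by linarith
  have hbs : Metric.ball y₀ ρ ⊆ s := fun x hx => (hball hx).1
  have hdiff : ∀ y ∈ Metric.ball y₀ ρ, DifferentiableAt ℝ f y := fun y hy =>
    (hf.contDiffAt (hU.mem_nhds (hball hy).2)).differentiableAt two_ne_zero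
  have hd1 : (1 : ℝ) ≤ d := by exact_mod_cast (by omega : 1 ≤ d)
  have htay : ∀ m m' : Metric.ball y₀ ρ, |f m' - f m - grad f m ⬝ᵥ ((m' : Fin d → ℝ) - m)| ≤
      d * K * ‖(m' : Fin d → ℝ) - m‖ ^ 2 := fun m m' =>
    taylor_of_grad_lipschitz (convex_ball y₀ ρ) hdiff hK0.le
      (fun x hx x' hx' => hlip x (hbs hx) x' (hbs hx')) m.2 m'.2
  have hlip' : ∀ m m' : Metric.ball y₀ ρ,
      ‖grad f m' - grad f m‖ ≤ K * ‖(m' : Fin d → ℝ) - m‖ := fun m m' =>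
    hlip _ (hbs m'.2) _ (hbs m.2)
  have hanti' : ∀ m m' : Metric.ball y₀ ρ,
      ‖(m' : Fin d → ℝ) - m‖ ≤ K * ‖grad f m' - grad f m‖ := fun m m' =>
    hanti _ (hbs m'.2) _ (hbs m.2)
  set L := d * K ^ 3 with hL
  have hKL : K ≤ L := by
    have h1 : K ≤ K ^ 3 := le_self_pow₀ hK (by norm_num)
    have h2 : 1 * K ^ 3 ≤ L := by rw [hL]; gcongr
    linarith
  have hdKL : d * K ≤ L := by
    rw [hL]; gcongr; exact le_self_pow₀ hK (by norm_num)
  have hL1 : 1 ≤ L := hK.trans hKL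
  set Y := ‖y₀‖ + ρ with hY
  set P := ‖grad f y₀‖ + K * ρ with hP
  set F := |f y₀| + d * (‖grad f y₀‖ * ρ) + L * ρ ^ 2 with hF
  have hnear : ∀ m : Metric.ball y₀ ρ, ‖(m : Fin d → ℝ) - y₀‖ ≤ ρ := fun m => by
    rw [← dist_eq_norm]; exact (Metric.mem_ball.1 m.2).le
  have hyle : ∀ m : Metric.ball y₀ ρ, ‖(m : Fin d → ℝ)‖ ≤ Y := fun m => by
    have h := norm_add_le y₀ ((m : Fin d → ℝ) - y₀)
    rw [add_sub_cancel] at h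
    linarith [hnear m]
  set m₀ : Metric.ball y₀ ρ := ⟨y₀, Metric.mem_ball_self hρ⟩
  have hple : ∀ m : Metric.ball y₀ ρ, ‖grad f m‖ ≤ P := fun m => by
    have h := norm_add_le (grad f y₀) (grad f m - grad f y₀)
    rw [add_sub_cancel] at h
    have h1 := hlip' m₀ m
    have h2 : K * ‖(m : Fin d → ℝ) - y₀‖ ≤ K * ρ := by gcongr; exact hnear m
    exact h.trans (by rw [hP]; gcongr; exact h1.trans h2)
  have hule : ∀ m : Metric.ball y₀ ρ, |f m| ≤ F := fun m => by
    have h1 := htay m₀ m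
    have h2 := abs_dotProduct_le (grad f y₀) ((m : Fin d → ℝ) - y₀)
    have h3 : d * (‖grad f y₀‖ * ‖(m : Fin d → ℝ) - y₀‖) ≤ d * (‖grad f y₀‖ * ρ) := by
      gcongr; exact hnear m
    have h4 : d * K * ‖(m : Fin d → ℝ) - y₀‖ ^ 2 ≤ L * ρ ^ 2 := by
      gcongr; exact hnear m
    have h5 := (h1.trans h4)
    have h6 := h2.trans h3
    have h7 : f m = f y₀ + (f m - f y₀ - grad f y₀ ⬝ᵥ ((m : Fin d → ℝ) - y₀)) +
        grad f y₀ ⬝ᵥ ((m : Fin d → ℝ) - y₀) := by ring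
    rw [h7, hF]
    exact (abs_add_three _ _ _).trans (by linarith)
  have hY0 : 0 ≤ Y := by positivity
  have hP0 : 0 ≤ P := by positivity
  have hF0 : 0 ≤ F := by positivity
  have hdYP : 0 ≤ d * (Y * P) := by positivity
  refine ⟨ρ, hρ, ⟨fun m => m, fun m => grad f m, fun m => f m,
    fun m => (m : Fin d → ℝ) ⬝ᵥ grad f m - f m, fun m => ‖(m : Fin d → ℝ) - y₀‖, L, ρ / 2,
    ρ / (4 * K), 1 + Y + P + F + d * (Y * P), hL1, by positivity, by linarith, ?_, ?_, ?_, ?_, ?_,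
    ?_, ?_, ?_, ?_, ?_, ?_, ?_, ?_⟩, fun _ => rfl, fun _ => rfl, fun _ => rfl, half_pos hρ, ?_⟩
  · intro m; ring
  · exact fun m m' => (hlip' m m').trans (by gcongr)
  · exact fun m m' => (hanti' m m').trans (by gcongr)
  · exact fun m m' => (htay m m').trans (by gcongr)
  · intro m m'
    have h1 := htay m' m
    have h2 := hanti' m m'
    have h3 : (m' : Fin d → ℝ) ⬝ᵥ grad f m' - f m' - ((m : Fin d → ℝ) ⬝ᵥ grad f m - f m) -
        (m : Fin d → ℝ) ⬝ᵥ (grad f m' - grad f m) =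
        f m - f m' - grad f m' ⬝ᵥ ((m : Fin d → ℝ) - m') := by
      rw [dotProduct_sub, dotProduct_sub, dotProduct_comm (m' : Fin d → ℝ),
        dotProduct_comm (grad f m') (m : Fin d → ℝ)]
      ring
    rw [h3]
    refine h1.trans ?_
    rw [norm_sub_rev]
    calc d * K * ‖(m' : Fin d → ℝ) - m‖ ^ 2
        ≤ d * K * (K * ‖grad f m' - grad f m‖) ^ 2 := by gcongr
      _ = _ := by rw [hL]; ring
  · intro m m'
    have h := norm_add_le ((m : Fin d → ℝ) - y₀) ((m' : Fin d → ℝ) - m)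
    rw [add_comm, sub_add_sub_cancel] at h
    refine h.trans ?_
    gcongr
    exact le_mul_of_one_le_left (norm_nonneg _) hL1
  · intro m m'
    have h := norm_add_le ((m : Fin d → ℝ) - y₀) ((m' : Fin d → ℝ) - m)
    rw [add_comm, sub_add_sub_cancel] at h
    refine h.trans ?_
    gcongr
    exact (hanti' m m').trans (by gcongr)
  · intro m hm q hq
    have h1 : ρ / (4 * K) ≤ ρ / 4 := by gcongr; linarith
    refine ⟨⟨q, ?_⟩, rfl⟩
    rw [Metric.mem_ball, dist_eq_norm]
    have h := norm_add_le (q - (m : Fin d → ℝ)) ((m : Fin d → ℝ) - y₀)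
    rw [sub_add_sub_cancel] at h
    linarith
  · intro m hm q hq
    have hsub : Metric.closedBall (m : Fin d → ℝ) (ρ / 4) ⊆ Metric.ball y₀ ρ := by
      intro x hx
      rw [Metric.mem_closedBall, dist_eq_norm] at hx
      rw [Metric.mem_ball, dist_eq_norm]
      have h := norm_add_le (x - (m : Fin d → ℝ)) ((m : Fin d → ℝ) - y₀)
      rw [sub_add_sub_cancel] at h
      linarith
    obtain ⟨x, hx, hxq⟩ := hsurj m (ρ / 4) (by positivity) (hsub.trans hbs) q
      (by rw [div_div]; exact hq)
    exact ⟨⟨x, hsub hx⟩, hxq⟩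
  · exact fun m => (hyle m).trans (by linarith)
  · exact fun m => (hple m).trans (by linarith)
  · exact fun m => (hule m).trans (by linarith)
  · intro m
    have h1 : |(m : Fin d → ℝ) ⬝ᵥ grad f m| ≤ d * (Y * P) := by
      refine (abs_dotProduct_le _ _).trans ?_
      gcongr
      · exact hyle m
      · exact hple m
    exact (abs_sub _ _).trans (by linarith [hule m])
  · change ρ / 2 ≤ ρ; linarith

/-- Admissible constants exist for every contact family. -/
lemma Contact.exists_params (hd : 2 ≤ d) {M : Type*} (c : Contact d M) (hR : 0 < c.R) {D : ℝ}
    (hD : 1 ≤ D) : ∃ h₀ e g : ℝ, h₀ ≤ 1 ∧ 0 < g ∧ Params c h₀ e (c.R / 2) g D := by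
  have hB := c.one_le_B
  have hL := c.one_le_L
  have hε := c.ε_pos
  have hdR : (2 : ℝ) ≤ d := by exact_mod_cast hd
  have hden : 1 ≤ 5 * d * c.B ^ 2 := by nlinarith [one_le_pow₀ hB (n := 2)]
  set h₀ := 1 / (5 * d * c.B ^ 2) with hh₀
  have hh : 0 < h₀ := by positivity
  obtain ⟨e, he, he'⟩ : ∃ e > (0 : ℝ), e ≤ h₀ ^ 2 ∧ e ≤ 1 / 2 ∧ e ≤ c.ε * h₀ ∧
      e ≤ h₀ / (32 * c.L ^ 3) ∧ e ≤ 1 / (3 * (d + 2 + c.L)) ∧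
      e ≤ c.R / 2 * h₀ / (32 * c.L) := by
    refine ⟨min (h₀ ^ 2) (min (1 / 2) (min (c.ε * h₀) (min (h₀ / (32 * c.L ^ 3))
      (min (1 / (3 * (d + 2 + c.L))) (c.R / 2 * h₀ / (32 * c.L)))))), by positivity, ?_⟩
    simp only [← le_min_iff, le_refl]
  obtain ⟨h1, h2, h3, h4, h5, h6⟩ := he'
  rw [le_div_iff₀ (by positivity)] at h4 h5 h6
  refine ⟨h₀, e, 32 * c.L * e, ?_, by positivity, hh, he, ?_, h1, h2, h3, by linarith, by linarith,
    rfl, ?_, hD⟩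
  · rw [hh₀, div_le_one (by positivity)]; exact hden
  · rw [hh₀, mul_one_div_cancel (by positivity)]
  · have : 32 * c.L * e / h₀ ≤ c.R / 2 := by
      rw [div_le_iff₀ hh]; linarith
    linarith

end Chart

section LocalCount

variable {d : ℕ}

lemma appendV_castSucc (y : Fin d → ℝ) (z : ℝ) (i : Fin d) :
    appendV (d + 1) d y z i.castSucc = y i := by
  simp [appendV]

lemma appendV_last (y : Fin d → ℝ) (z : ℝ) : appendV (d + 1) d y z (Fin.last d) = z := by
  simp [appendV]

open Matrix in
/-- The linear isometry that splits a denominator and a numerator vector according to the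
orthonormal frame `O`. -/
noncomputable def frame (O : Matrix (Fin (d + 1)) (Fin (d + 1)) ℝ)
    (hO : O ∈ Matrix.orthogonalGroup (Fin (d + 1)) ℝ) :
    (Option (Fin (d + 1)) → ℝ) ≃ₗ[ℝ] Amb d where
  toFun z := (z none, fun i => (Oᵀ *ᵥ fun j => z (some j)) i.castSucc,
    (Oᵀ *ᵥ fun j => z (some j)) (Fin.last d))
  map_add' z w := by
    have h : (fun j => (z + w) (some j)) = (fun j => z (some j)) + fun j => w (some j) := rfl
    rw [h, mulVec_add]
    rfl
  map_smul' a z := by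
    have h : (fun j => (a • z) (some j)) = a • fun j => z (some j) := rfl
    rw [h, mulVec_smul]
    rfl
  invFun x o := o.elim x.1 (O *ᵥ appendV (d + 1) d x.2.1 x.2.2)
  left_inv z := by
    have h : appendV (d + 1) d (fun i => (Oᵀ *ᵥ fun j => z (some j)) i.castSucc)
        ((Oᵀ *ᵥ fun j => z (some j)) (Fin.last d)) = Oᵀ *ᵥ fun j => z (some j) := by
      ext i
      refine Fin.lastCases ?_ (fun i => ?_) i
      · rw [appendV_last]
      · rw [appendV_castSucc]
    ext o
    rcases o with _ | j
    · rfl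
    · simp only [Option.elim]
      rw [h, mulVec_mulVec, (Matrix.mem_orthogonalGroup_iff _ _).1 hO, one_mulVec]
  right_inv x := by
    have h : Oᵀ *ᵥ (O *ᵥ appendV (d + 1) d x.2.1 x.2.2) = appendV (d + 1) d x.2.1 x.2.2 := by
      rw [mulVec_mulVec, (Matrix.mem_orthogonalGroup_iff' _ _).1 hO, one_mulVec]
    simp only [Option.elim]
    rw [h]
    ext i
    · rfl
    · exact appendV_castSucc _ _ _
    · exact appendV_last _ _

open Matrix in
lemma frame_isometric (O : Matrix (Fin (d + 1)) (Fin (d + 1)) ℝ)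
    (hO : O ∈ Matrix.orthogonalGroup (Fin (d + 1)) ℝ) : Isometric (frame O hO) := by
  intro z w
  have h : (Oᵀ *ᵥ fun j => z (some j)) ⬝ᵥ (Oᵀ *ᵥ fun j => w (some j)) =
      (fun j => z (some j)) ⬝ᵥ fun j => w (some j) := by
    rw [dotProduct_mulVec, vecMul_mulVec, transpose_transpose,
      (Matrix.mem_orthogonalGroup_iff _ _).1 hO, vecMul_one]
  have h2 : z ⬝ᵥ w = z none * w none + (fun j => z (some j)) ⬝ᵥ fun j => w (some j) := by
    simp only [dotProduct, Fintype.sum_option]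
  rw [h2, ← h]
  simp only [dotProduct, Fin.sum_univ_castSucc]
  rw [← add_assoc]
  rfl

/-- The error factor of the counting bound. -/
noncomputable def err (d : ℕ) (b Q : ℝ) : ℝ := if d = 2 then Real.exp (b * √(Real.log Q)) else 1

lemma one_le_err (d : ℕ) {b : ℝ} (hb : 0 ≤ b) (Q : ℝ) : 1 ≤ err d b Q := by
  unfold err
  split_ifs
  · exact Real.one_le_exp (by positivity)
  · exact le_rfl

lemma err_mono (d : ℕ) {b b' : ℝ} (hb : b ≤ b') (Q : ℝ) : err d b Q ≤ err d b' Q := by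
  unfold err
  split_ifs
  · gcongr
  · exact le_rfl

/-- The rational points with bounded denominator in a bounded region are bounded in number. -/
lemma exists_card_le_of_bounded {n : ℕ} (q₀ K : ℝ) : ∃ N : ℝ, 0 ≤ N ∧
    ∀ F : Finset ((Fin n → ℤ) × ℤ), (∀ z ∈ F, 1 ≤ z.2 ∧ (z.2 : ℝ) ≤ q₀ ∧
      ‖fun i => (z.1 i : ℝ) / (z.2 : ℝ)‖ ≤ K) → (F.card : ℝ) ≤ N := by
  refine ⟨((Finset.Icc (fun _ : Fin n => -⌈q₀ * K⌉) (fun _ => ⌈q₀ * K⌉) ×ˢ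
    Finset.Icc (1 : ℤ) ⌈q₀⌉).card : ℝ), by positivity, fun F hF => ?_⟩
  refine Nat.cast_le.2 (Finset.card_le_card fun z hz => ?_)
  obtain ⟨h1, h2, h3⟩ := hF z hz
  have hz0 : (0 : ℝ) < z.2 := by exact_mod_cast (by omega : 0 < z.2)
  have hK : 0 ≤ K := (norm_nonneg _).trans h3
  have h4 : ∀ i, |z.1 i| ≤ ⌈q₀ * K⌉ := by
    intro i
    have h5 := (norm_le_pi_norm _ i).trans h3
    rw [Real.norm_eq_abs, abs_div, abs_of_pos hz0, div_le_iff₀ hz0] at h5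
    have h6 : |(z.1 i : ℝ)| ≤ q₀ * K := h5.trans (by rw [mul_comm]; gcongr)
    have h7 := h6.trans (Int.le_ceil _)
    exact_mod_cast h7
  rw [Finset.mem_product, Finset.mem_Icc, Finset.mem_Icc]
  refine ⟨⟨fun i => (abs_le.1 (h4 i)).1, fun i => (abs_le.1 (h4 i)).2⟩, h1, ?_⟩
  have h5 := h2.trans (Int.le_ceil q₀)
  exact_mod_cast h5

open Matrix in
lemma exists_norm_mulVec_le {n : ℕ} (A : Matrix (Fin n) (Fin n) ℝ) :
    ∃ C : ℝ, 1 ≤ C ∧ ∀ v, ‖A *ᵥ v‖ ≤ C * ‖v‖ := by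
  have h := norm_nonneg A.mulVecLin.toContinuousLinearMap
  refine ⟨1 + ‖A.mulVecLin.toContinuousLinearMap‖, by linarith, fun v => ?_⟩
  refine (A.mulVecLin.toContinuousLinearMap.le_opNorm v).trans ?_
  gcongr
  linarith

/-- The integer vector with denominator `z.2` and numerators `z.1`. -/
def encode {n : ℕ} (z : (Fin n → ℤ) × ℤ) : Option (Fin n) → ℤ := fun o => o.elim z.2 z.1

lemma encode_injective {n : ℕ} : Function.Injective (encode (n := n)) := by
  intro z w h
  ext i
  · exact congrFun h (some i)
  · exact congrFun h none

open Matrix in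
/-- The counting bound for the rational points near a small piece of the hypersurface. -/
lemma exists_local_card_le (hd : 2 ≤ d) {S : Set (Fin (d + 1) → ℝ)} {x : Fin (d + 1) → ℝ}
    (hx : x ∈ S) {O : Matrix (Fin (d + 1)) (Fin (d + 1)) ℝ}
    (hO : O ∈ Matrix.orthogonalGroup (Fin (d + 1)) ℝ) {U : Set (Fin d → ℝ)} (hU : IsOpen U)
    {f : (Fin d → ℝ) → ℝ} (hf : ContDiffOn ℝ 2 f U) (hdet : ∀ y ∈ U, (hess f y).det ≠ 0)
    {ε : ℝ} (hε : 0 < ε) (hS : S ∩ Metric.ball x ε =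
      (O.mulVec '' {p | ∃ y ∈ U, p = appendV (d + 1) d y (f y)}) ∩ Metric.ball x ε) :
    ∃ η > (0 : ℝ), ∃ A > (0 : ℝ), ∃ b > (0 : ℝ), ∀ Q δ : ℝ, 2 ≤ Q → 0 < δ → δ < 1 / 2 →
      ∀ F : Finset ((Fin (d + 1) → ℤ) × ℤ), (∀ z ∈ F, 1 ≤ z.2 ∧ (z.2 : ℝ) ≤ Q ∧
        ∃ s ∈ S ∩ Metric.ball x η,
          dist (fun i => (z.1 i : ℝ) / (z.2 : ℝ)) s ≤ δ / (z.2 : ℝ)) →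
        (F.card : ℝ) ≤ A * (δ * Q ^ (d + 1) + Q ^ d * err d b Q) := by
  classical
  have hgraph : ∀ s ∈ S ∩ Metric.ball x ε, ∃ y ∈ U, Oᵀ *ᵥ s = appendV (d + 1) d y (f y) := by
    intro s hs
    rw [hS] at hs
    obtain ⟨⟨_, ⟨y, hy, rfl⟩, rfl⟩, -⟩ := hs
    exact ⟨y, hy, by
      rw [mulVec_mulVec, (Matrix.mem_orthogonalGroup_iff' _ _).1 hO, one_mulVec]⟩
  obtain ⟨y₀, hy₀, hxy⟩ := hgraph x ⟨hx, Metric.mem_ball_self hε⟩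
  obtain ⟨ρ, hρ, c, hcy, hcu, hcrad, hR, hRρ⟩ := exists_contact hd hU hf hy₀ (hdet y₀ hy₀)
  obtain ⟨C, hC, hOC⟩ := exists_norm_mulVec_le Oᵀ
  have hB := c.one_le_B
  have hL := c.one_le_L
  set D := C * (1 + d * c.B + c.L) with hD
  have hdB : 0 ≤ d * c.B := by positivity
  have hD1 : 1 ≤ D := by rw [hD]; nlinarith
  obtain ⟨h₀, e, g, hh1, hg, P⟩ := c.exists_params hd hR hD1
  have hh := P.h₀_pos
  obtain ⟨A, hA, b, hb, hbound⟩ := exists_bound hd (frame_isometric O hO) P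
  set η := min ε (c.R / (8 * C)) with hη
  have hη0 : 0 < η := by positivity
  set q₀ := 4 * C / c.R + C with hq₀
  obtain ⟨N, hN0, hN⟩ := exists_card_le_of_bounded (n := d + 1) q₀ (‖x‖ + η + 1)
  refine ⟨η, hη0, A * D + A + N, by positivity, b, hb, fun Q δ hQ hδ hδ2 F hF => ?_⟩
  have hfar : ∀ z ∈ F.filter fun z => q₀ ≤ z.2,
      Near (frame O hO) c h₀ (c.R / 2 + g / Q) Q (D * δ) (encode z) := by
    intro z hz
    obtain ⟨hzF, hzq⟩ := Finset.mem_filter.1 hz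
    obtain ⟨h1, h2, s, ⟨hsS, hsx⟩, hs⟩ := hF z hzF
    set q : ℝ := (z.2 : ℝ) with hq
    have hq1 : (1 : ℝ) ≤ q := by rw [hq]; exact_mod_cast h1
    have hq0 : 0 < q := by linarith
    obtain ⟨y, hy, hsy⟩ := hgraph s ⟨hsS, Metric.ball_subset_ball (min_le_left _ _) hsx⟩
    set v : Fin (d + 1) → ℝ := (fun i => (z.1 i : ℝ) / q) - s with hv
    set w := Oᵀ *ᵥ v with hw
    set t := C * (δ / q) with ht
    have hwt : ‖w‖ ≤ t := by
      refine (hOC v).trans ?_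
      rw [dist_eq_norm] at hs
      exact mul_le_mul_of_nonneg_left hs (by linarith)
    have ht0 : 0 ≤ t := by positivity
    have htq : q * t = C * δ := by rw [ht]; field_simp
    have hCq : 4 * C ≤ q * c.R := by
      have h3 : 4 * C / c.R ≤ q := by linarith
      rwa [div_le_iff₀ hR] at h3
    have ht8 : t ≤ c.R / 8 := by nlinarith
    have ht1 : t ≤ 1 := by
      have h3 : 0 < 4 * C / c.R := by positivity
      nlinarith
    have hlat : Oᵀ *ᵥ (fun j => (z.1 j : ℝ)) = q • (appendV (d + 1) d y (f y) + w) := by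
      rw [hw, hv, mulVec_sub, hsy, add_sub_cancel, ← mulVec_smul]
      congr 1
      ext j
      rw [Pi.smul_apply, smul_eq_mul, mul_div_cancel₀ _ hq0.ne']
    have hyy₀ : ‖y - y₀‖ ≤ c.R / 8 := by
      rw [pi_norm_le_iff_of_nonneg (by positivity)]
      intro i
      have h3 : (y - y₀) i = (Oᵀ *ᵥ (s - x)) i.castSucc := by
        rw [mulVec_sub, hsy, hxy, Pi.sub_apply, Pi.sub_apply, appendV_castSucc, appendV_castSucc]
      rw [h3]
      refine (norm_le_pi_norm _ _).trans ((hOC _).trans ?_)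
      rw [Metric.mem_ball, dist_eq_norm] at hsx
      calc C * ‖s - x‖ ≤ C * (c.R / (8 * C)) := by
            gcongr; exact hsx.le.trans (min_le_right _ _)
        _ = _ := by field_simp
    set y₁ : Fin d → ℝ := y + fun i => w i.castSucc with hy₁
    have hy₁y : ‖y₁ - y‖ ≤ t := by
      rw [hy₁, add_sub_cancel_left, pi_norm_le_iff_of_nonneg ht0]
      exact fun i => (norm_le_pi_norm w _).trans hwt
    have hy₁y₀ : ‖y₁ - y₀‖ ≤ c.R / 4 := by
      have h3 := norm_add_le (y₁ - y) (y - y₀)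
      rw [sub_add_sub_cancel] at h3
      linarith
    set m : Metric.ball y₀ ρ := ⟨y, by rw [Metric.mem_ball, dist_eq_norm]; linarith⟩ with hm
    set m₁ : Metric.ball y₀ ρ := ⟨y₁, by rw [Metric.mem_ball, dist_eq_norm]; linarith⟩ with hm₁
    have hfy : |f y₁ - f y| ≤ (d * c.B + c.L) * t := by
      have h3 := c.taylor_u m m₁
      rw [hcu, hcu, hcy, hcy] at h3
      change |f y₁ - f y - c.p m ⬝ᵥ (y₁ - y)| ≤ c.L * ‖y₁ - y‖ ^ 2 at h3
      have h4 : |c.p m ⬝ᵥ (y₁ - y)| ≤ d * (c.B * t) := by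
        refine (abs_dotProduct_le _ _).trans ?_
        gcongr
        exact c.norm_p_le m
      have h5 : c.L * ‖y₁ - y‖ ^ 2 ≤ c.L * t := by
        gcongr
        calc ‖y₁ - y‖ ^ 2 ≤ t ^ 2 := by gcongr
          _ ≤ t := by nlinarith
      have h6 := abs_add_le (f y₁ - f y - c.p m ⬝ᵥ (y₁ - y)) (c.p m ⬝ᵥ (y₁ - y))
      rw [sub_add_cancel] at h6
      linarith
    have hfirst : (lat (frame O hO) (encode z)).1 = q := rfl
    have hmid : (lat (frame O hO) (encode z)).2.1 = q • y₁ := by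
      ext i
      change (Oᵀ *ᵥ fun j => (z.1 j : ℝ)) i.castSucc = _
      rw [hlat, Pi.smul_apply, Pi.add_apply, appendV_castSucc]
      rfl
    have hlast : (lat (frame O hO) (encode z)).2.2 = q * (f y + w (Fin.last d)) := by
      change (Oᵀ *ᵥ fun j => (z.1 j : ℝ)) (Fin.last d) = _
      rw [hlat, Pi.smul_apply, Pi.add_apply, appendV_last, smul_eq_mul]
    refine ⟨by rw [hfirst]; linarith, h2, m₁, ?_, by rw [hcy]; exact hmid, ?_⟩
    · rw [hcrad]
      have : 0 ≤ g / Q := by positivity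
      change ‖y₁ - y₀‖ ≤ _
      linarith
    · rw [hlast, hfirst, hcu]
      change |q * (f y + w (Fin.last d)) - q * f y₁| ≤ _
      have h3 : |w (Fin.last d)| ≤ t := (norm_le_pi_norm w _).trans hwt
      have h4 : q * (f y + w (Fin.last d)) - q * f y₁ =
          q * (w (Fin.last d) - (f y₁ - f y)) := by ring
      rw [h4, abs_mul, abs_of_pos hq0]
      calc q * |w (Fin.last d) - (f y₁ - f y)| ≤ q * (t + (d * c.B + c.L) * t) := by
            gcongr
            exact (abs_sub _ _).trans (by linarith)
        _ = (q * t) * (1 + d * c.B + c.L) := by ring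
        _ = _ := by rw [htq, hD]; ring
  have hfarcard : ((F.filter fun z => q₀ ≤ z.2).card : ℝ) ≤
      A * (D * δ) * Q ^ (d + 1) + A * err d b Q * Q ^ d := by
    have h1 := hbound Q hQ Q (D * δ) ((F.filter fun z => q₀ ≤ z.2).image encode) (by linarith)
      le_rfl (by positivity) (by nlinarith) (by
        intro z hz
        obtain ⟨z', hz', rfl⟩ := Finset.mem_image.1 hz
        exact hfar z' hz')
    rwa [Finset.card_image_of_injective _ encode_injective] at h1
  have hnearcard : ((F.filter fun z => ¬ q₀ ≤ z.2).card : ℝ) ≤ N := by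
    refine hN _ fun z hz => ?_
    obtain ⟨hzF, hzq⟩ := Finset.mem_filter.1 hz
    obtain ⟨h1, h2, s, ⟨hsS, hsx⟩, hs⟩ := hF z hzF
    refine ⟨h1, (not_le.1 hzq).le, ?_⟩
    have hq1 : (1 : ℝ) ≤ z.2 := by exact_mod_cast h1
    rw [dist_eq_norm] at hs
    rw [Metric.mem_ball, dist_eq_norm] at hsx
    have h3 : δ / (z.2 : ℝ) ≤ 1 := (div_le_one (by linarith)).2 (by linarith)
    have h4 := norm_add₃_le (a := (fun i => (z.1 i : ℝ) / (z.2 : ℝ)) - s) (b := s - x) (c := x)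
    rw [sub_add_sub_cancel, sub_add_cancel] at h4
    linarith
  have hE := one_le_err d hb.le Q
  have hQd : 1 ≤ Q ^ d := one_le_pow₀ (by linarith)
  have hsum : (F.card : ℝ) = (F.filter fun z => q₀ ≤ z.2).card +
      (F.filter fun z => ¬ q₀ ≤ z.2).card := by
    exact_mod_cast (Finset.card_filter_add_card_filter_not fun z : (Fin (d + 1) → ℤ) × ℤ => q₀ ≤ z.2).symm
  have hNE : N ≤ N * (Q ^ d * err d b Q) := by
    refine le_mul_of_one_le_right hN0 ?_
    nlinarith
  have hpos1 : 0 ≤ δ * Q ^ (d + 1) := by positivity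
  have hpos2 : 0 ≤ Q ^ d * err d b Q := by positivity
  have hrest : 0 ≤ (A + N) * (δ * Q ^ (d + 1)) + A * D * (Q ^ d * err d b Q) := by positivity
  linarith

end LocalCount

section Global

variable {d : ℕ}

/-- Local counting bounds along a nonempty compact set add up to a global one. -/
lemma exists_card_le_of_local {S : Set (Fin (d + 1) → ℝ)} (hS : IsCompact S) (hne : S.Nonempty)
    (hloc : ∀ x ∈ S, ∃ η > (0 : ℝ), ∃ A > (0 : ℝ), ∃ b > (0 : ℝ), ∀ Q δ : ℝ, 2 ≤ Q → 0 < δ →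
      δ < 1 / 2 → ∀ F : Finset ((Fin (d + 1) → ℤ) × ℤ), (∀ z ∈ F, 1 ≤ z.2 ∧ (z.2 : ℝ) ≤ Q ∧
        ∃ s ∈ S ∩ Metric.ball x η,
          dist (fun i => (z.1 i : ℝ) / (z.2 : ℝ)) s ≤ δ / (z.2 : ℝ)) →
        (F.card : ℝ) ≤ A * (δ * Q ^ (d + 1) + Q ^ d * err d b Q)) :
    ∃ A > (0 : ℝ), ∃ b > (0 : ℝ), ∀ Q δ : ℝ, 2 ≤ Q → 0 < δ → δ < 1 / 2 →
      (Nat.card {p : (Fin (d + 1) → ℤ) × ℤ | 1 ≤ p.2 ∧ (p.2 : ℝ) ≤ Q ∧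
        Metric.infDist (fun i => (p.1 i : ℝ) / (p.2 : ℝ)) S ≤ δ / (p.2 : ℝ)} : ℝ) ≤
        A * (δ * Q ^ (d + 1) + Q ^ d * err d b Q) := by
  classical
  choose! η hη A hA b hb hcount using hloc
  obtain ⟨t, htS, hcover⟩ := hS.elim_nhds_subcover (fun x => Metric.ball x (η x))
    fun x hx => Metric.ball_mem_nhds x (hη x hx)
  have hAt : 0 ≤ ∑ x ∈ t, A x := Finset.sum_nonneg fun x hx => (hA x (htS x hx)).le
  have hbt : 0 ≤ ∑ x ∈ t, b x := Finset.sum_nonneg fun x hx => (hb x (htS x hx)).le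
  refine ⟨1 + ∑ x ∈ t, A x, by linarith, 1 + ∑ x ∈ t, b x, by linarith, fun Q δ hQ hδ hδ2 => ?_⟩
  set P := {p : (Fin (d + 1) → ℤ) × ℤ | 1 ≤ p.2 ∧ (p.2 : ℝ) ≤ Q ∧
    Metric.infDist (fun i => (p.1 i : ℝ) / (p.2 : ℝ)) S ≤ δ / (p.2 : ℝ)} with hP
  have hE : ∀ b', 0 ≤ b' → 0 ≤ δ * Q ^ (d + 1) + Q ^ d * err d b' Q := fun b' hb' => by
    have := one_le_err d hb' Q
    positivity
  rcases P.finite_or_infinite with hfin | hinf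
  swap
  · have : Infinite P := hinf.to_subtype
    rw [Nat.card_eq_zero_of_infinite, Nat.cast_zero]
    exact mul_nonneg (by linarith) (hE _ (by linarith))
  set near : (Fin (d + 1) → ℝ) → (Fin (d + 1) → ℤ) × ℤ → Prop := fun x z =>
    ∃ s ∈ S ∩ Metric.ball x (η x),
      dist (fun i => (z.1 i : ℝ) / (z.2 : ℝ)) s ≤ δ / (z.2 : ℝ) with hnear
  have hsub : hfin.toFinset ⊆ t.biUnion fun x => hfin.toFinset.filter (near x) := by
    intro z hz
    obtain ⟨h1, h2, h3⟩ := hfin.mem_toFinset.1 hz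
    obtain ⟨s, hs, hds⟩ := hS.exists_infDist_eq_dist hne fun i => (z.1 i : ℝ) / (z.2 : ℝ)
    rw [hds] at h3
    obtain ⟨x, hx, hsx⟩ := Set.mem_iUnion₂.1 (hcover hs)
    exact Finset.mem_biUnion.2 ⟨x, hx, Finset.mem_filter.2 ⟨hz, s, ⟨hs, hsx⟩, h3⟩⟩
  rw [Nat.card_coe_set_eq, Set.ncard_eq_toFinset_card P hfin]
  calc (hfin.toFinset.card : ℝ)
      ≤ ∑ x ∈ t, ((hfin.toFinset.filter (near x)).card : ℝ) := by
        exact_mod_cast (Finset.card_le_card hsub).trans Finset.card_biUnion_le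
    _ ≤ ∑ x ∈ t, A x * (δ * Q ^ (d + 1) + Q ^ d * err d (1 + ∑ x ∈ t, b x) Q) := by
        refine Finset.sum_le_sum fun x hx => ?_
        refine (hcount x (htS x hx) Q δ hQ hδ hδ2 _ fun z hz => ?_).trans ?_
        · obtain ⟨hz1, hz2⟩ := Finset.mem_filter.1 hz
          obtain ⟨h1, h2, -⟩ := hfin.mem_toFinset.1 hz1
          exact ⟨h1, h2, hz2⟩
        · have h1 : b x ≤ 1 + ∑ x ∈ t, b x := by
            have := Finset.single_le_sum (fun x hx => (hb x (htS x hx)).le) hx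
            linarith
          have h2 := (hA x (htS x hx)).le
          gcongr
          exact err_mono d h1 Q
    _ = (∑ x ∈ t, A x) * (δ * Q ^ (d + 1) + Q ^ d * err d (1 + ∑ x ∈ t, b x) Q) := by
        rw [Finset.sum_mul]
    _ ≤ _ := by
        have := hE (1 + ∑ x ∈ t, b x) (by linarith)
        gcongr
        linarith

/-- Every rational point is counted when the set is empty, and `Nat.card` is then zero. -/
lemma natCard_eq_zero_of_empty {n : ℕ} [Nonempty (Fin n)] {Q δ : ℝ} (hQ : 1 ≤ Q) (hδ : 0 ≤ δ) :
    Nat.card {p : (Fin n → ℤ) × ℤ | 1 ≤ p.2 ∧ (p.2 : ℝ) ≤ Q ∧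
      Metric.infDist (fun i => (p.1 i : ℝ) / (p.2 : ℝ)) ∅ ≤ δ / (p.2 : ℝ)} = 0 := by
  have hinf := Set.infinite_of_injective_forall_mem (f := fun p : Fin n → ℤ => (p, (1 : ℤ)))
    (s := {p : (Fin n → ℤ) × ℤ | 1 ≤ p.2 ∧ (p.2 : ℝ) ≤ Q ∧
      Metric.infDist (fun i => (p.1 i : ℝ) / (p.2 : ℝ)) ∅ ≤ δ / (p.2 : ℝ)})
    (fun p p' h => congrArg Prod.fst h) fun p => by
      refine ⟨le_rfl, by simpa using hQ, ?_⟩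
      rw [Metric.infDist_empty]
      simpa using hδ
  have := hinf.to_subtype
  exact Nat.card_eq_zero_of_infinite

/-- The error factor is dominated by the error term of the theorem. -/
lemma pow_mul_err_le (hd : 2 ≤ d) {b Q : ℝ} (hQ : 2 ≤ Q) :
    Q ^ d * err d b Q ≤ 2 * (if d + 1 = 3 then Q ^ 2 * Real.exp (b * √(Real.log Q))
      else Q ^ (d + 1 - 1) * Real.log Q ^ (1 : ℝ)) := by
  have hQ0 : 0 < Q := by linarith
  have hlog : 1 ≤ 2 * Real.log Q := by
    have := Real.log_le_log two_pos hQ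
    linarith [Real.log_two_gt_d9]
  by_cases h : d = 2
  · subst h
    rw [err, if_pos rfl, if_pos rfl]
    have : 0 < Q ^ 2 * Real.exp (b * √(Real.log Q)) := by positivity
    linarith
  · rw [err, if_neg h, if_neg (by omega), Nat.add_sub_cancel, Real.rpow_one]
    have : 0 < Q ^ d := by positivity
    nlinarith

end Global

end HypersurfaceCount

theorem statement0 (n : ℕ) (hn : 3 ≤ n) (l : ℕ)
    (hl : l = max ((n - 1) / 2 + 5) (n + 1))
    (S : Set (Fin n → ℝ)) (hScomp : IsCompact S)
    -- `S` is a `C^l` hypersurface with Gaussian curvature bounded away from zero: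
    -- every point has, after an orthogonal change of coordinates, a Monge chart
    -- with Hessian determinant bounded below by `c₁ > 0`.
    (c₁ : ℝ) (hc₁ : 0 < c₁)
    (hchart : ∀ x ∈ S, ∃ O : Matrix (Fin n) (Fin n) ℝ,
      O ∈ Matrix.orthogonalGroup (Fin n) ℝ ∧
      ∃ D : Set (Fin (n - 1) → ℝ), IsOpen D ∧
      ∃ f : (Fin (n - 1) → ℝ) → ℝ, ContDiffOn ℝ (l : ℕ∞) f D ∧
      (∀ y ∈ D, c₁ ≤ |(hess f y).det|) ∧
      ∃ ε > (0 : ℝ), S ∩ Metric.ball x ε =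
        (O.mulVec '' {p | ∃ y ∈ D, p = appendV n (n - 1) y (f y)}) ∩ Metric.ball x ε) :
    ∃ c > (0 : ℝ), ∃ κ > (0 : ℝ), ∃ C > (0 : ℝ), ∀ Q δ : ℝ, 2 ≤ Q → 0 < δ → δ < 1 / 2 →
      (Nat.card {p : (Fin n → ℤ) × ℤ | 1 ≤ p.2 ∧ (p.2 : ℝ) ≤ Q ∧
          Metric.infDist (fun i => (p.1 i : ℝ) / (p.2 : ℝ)) S ≤ δ / (p.2 : ℝ)} : ℝ)
        ≤ C * (δ * Q ^ n +
          (if n = 3 then Q ^ 2 * Real.exp (c * Real.sqrt (Real.log Q))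
           else Q ^ (n - 1) * Real.log Q ^ κ)) := by
  obtain ⟨d, rfl⟩ : ∃ d, n = d + 1 := ⟨n - 1, by omega⟩
  have hd : 2 ≤ d := by omega
  rcases S.eq_empty_or_nonempty with rfl | hne
  · refine ⟨1, one_pos, 1, one_pos, 1, one_pos, fun Q δ hQ hδ _ => ?_⟩
    rw [HypersurfaceCount.natCard_eq_zero_of_empty (by linarith) hδ.le, Nat.cast_zero]
    have hlog : 0 ≤ Real.log Q := Real.log_nonneg (by linarith)
    have hQ0 : 0 < Q := by linarith
    split_ifs <;> positivity
  · obtain ⟨A, hA, b, hb, h⟩ := HypersurfaceCount.exists_card_le_of_local hScomp hne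
      fun x hx => by
        obtain ⟨O, hO, U, hU, f, hf, hdet, ε, hε, heq⟩ := hchart x hx
        refine HypersurfaceCount.exists_local_card_le hd hx hO hU (hf.of_le ?_) (fun y hy h0 => ?_)
          hε heq
        · have h2 : ((2 : ℕ) : ℕ∞) ≤ (l : ℕ∞) := Nat.cast_le.2 (by omega)
          exact WithTop.coe_le_coe.2 h2
        · have h1 := hdet y hy
          rw [show (hess f y).det = 0 from h0, abs_zero] at h1
          linarith
    refine ⟨b, hb, 1, one_pos, 2 * A, by positivity, fun Q δ hQ hδ hδ2 => ?_⟩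
    refine (h Q δ hQ hδ hδ2).trans ?_
    have h1 := HypersurfaceCount.pow_mul_err_le hd (b := b) hQ
    have hQ0 : 0 < Q := by linarith
    have h2 : 0 ≤ δ * Q ^ (d + 1) := by positivity
    rw [mul_comm 2 A, mul_assoc]
    gcongr
    linarith
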